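/- arXiv:2008.09251 — 3 statements merged into one kernel-verified Lean document; each statement's English description precedes it below -/
import Mathlib

section
/- Consider the FPL algorithm for the experts problem with n experts run with η = √((1+ln n)/T): sample r_0(a) i.i.d. from Exp(η) for each expert a, and in round t play a_t = argmax_a (r_0(a) + Σ_{τ=1}^{t−1} ℓ_τ(a)). Then for any adversarially chosen reward vectors ℓ_1, …, ℓ_T ∈ [0,1]^n, the expected regret satisfies max_a Σ_{t=1}^T ℓ_t(a) − E[Σ_{t=1}^T ℓ_t(a_t)] ≤ 2√((1+ln n)·T). -/
open MeasureTheory ProbabilityTheory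

lemma fpl_expMeasure_eq (η : ℝ) :
    expMeasure η = volume.withDensity (exponentialPDF η) := rfl

lemma fpl_measurable_pdf (η : ℝ) : Measurable (exponentialPDF η) :=
  (measurable_exponentialPDFReal η).ennreal_ofReal

lemma fpl_exp_shift (η δ : ℝ) (hδ : 0 ≤ δ) (S : Set ℝ) (hS : MeasurableSet S) :
    expMeasure η ((fun x => x + δ) ⁻¹' S) ≤ ENNReal.ofReal (Real.exp (η * δ)) * expMeasure η S := by
  have hm : Measurable (fun x : ℝ => x + δ) := by fun_prop
  rw [fpl_expMeasure_eq, withDensity_apply _ (hm hS), withDensity_apply _ hS,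
    ← lintegral_indicator (hm hS), ← lintegral_indicator hS,
    ← lintegral_add_right_eq_self (μ := volume) (fun x => S.indicator (exponentialPDF η) x) δ,
    ← lintegral_const_mul]
  · apply lintegral_mono
    intro x
    by_cases hx : x + δ ∈ S
    · have hx' : x ∈ (fun x => x + δ) ⁻¹' S := hx
      simp only [Set.indicator_of_mem hx, Set.indicator_of_mem hx']
      rcases lt_or_ge x 0 with h | h
      · rw [exponentialPDF_of_neg h]; exact zero_le
      · rw [exponentialPDF_of_nonneg h, exponentialPDF_of_nonneg (by linarith),
          ← ENNReal.ofReal_mul (Real.exp_pos _).le]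
        apply ENNReal.ofReal_le_ofReal
        have : Real.exp (η * δ) * (η * Real.exp (-(η * (x + δ)))) = η * Real.exp (-(η * x)) := by
          rw [mul_left_comm, ← Real.exp_add]; ring_nf
        rw [this]
    · have hx' : x ∉ (fun x => x + δ) ⁻¹' S := hx
      simp [Set.indicator_of_notMem hx']
  · exact ((fpl_measurable_pdf η).indicator hS).comp hm

lemma fpl_exp_tail (η s : ℝ) (hη : 0 < η) (hs : 0 ≤ s) :
    expMeasure η (Set.Ioi s) = ENNReal.ofReal (Real.exp (-(η * s))) := by
  have := isProbabilityMeasure_expMeasure hη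
  have h := cdf_expMeasure_eq hη s
  rw [cdf_eq_real, if_pos hs] at h
  have h2 : (expMeasure η).real (Set.Ioi s) = Real.exp (-(η * s)) := by
    rw [← Set.compl_Iic, probReal_compl_eq_one_sub measurableSet_Iic, h]; ring
  rw [← h2, ofReal_measureReal]

lemma fpl_exp_nonneg (η : ℝ) (hη : 0 < η) : ∀ᵐ x ∂(expMeasure η), 0 ≤ x := by
  have := isProbabilityMeasure_expMeasure hη
  have h := fpl_exp_tail η 0 hη le_rfl
  have : ∀ᵐ x ∂(expMeasure η), x ∈ Set.Ioi (0:ℝ) := by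
    refine (mem_ae_iff_prob_eq_one measurableSet_Ioi).2 ?_
    rw [h]; simp
  filter_upwards [this] with x hx using le_of_lt hx

lemma fpl_exp_excess (η c : ℝ) (hη : 0 < η) (hc : 0 ≤ c) :
    ∫⁻ x, ENNReal.ofReal (max (x - c) 0) ∂(expMeasure η)
      = ENNReal.ofReal (Real.exp (-(η * c)) / η) := by
  rw [lintegral_eq_lintegral_meas_lt (f := fun x => max (x - c) 0) _ (Filter.Eventually.of_forall fun x => le_max_right _ _)
    (by fun_prop)]
  have : ∀ t ∈ Set.Ioi (0:ℝ), expMeasure η {a | t < max (a - c) 0}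
      = ENNReal.ofReal (Real.exp (-(η * c)) * Real.exp (-η * t)) := by
    intro t ht
    have ht' : (0:ℝ) < t := ht
    have : {a | t < max (a - c) 0} = Set.Ioi (c + t) := by
      ext a; simp only [Set.mem_ofPred_eq, Set.mem_Ioi, lt_max_iff]
      constructor
      · rintro (h | h) <;> linarith
      · intro h; left; linarith
    rw [this, fpl_exp_tail η _ hη (by linarith), ← Real.exp_add]; ring_nf
  rw [setLIntegral_congr_fun measurableSet_Ioi this, ← ofReal_integral_eq_lintegral_ofReal]
  · rw [integral_const_mul, integral_exp_mul_Ioi (by linarith)]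
    congr 1; simp [div_eq_mul_inv]
  · exact (integrableOn_exp_mul_Ioi (by linarith) 0).const_mul _
  · exact Filter.Eventually.of_forall fun x => by positivity

lemma fpl_exp_null (η x : ℝ) : expMeasure η {x} = 0 := by
  rw [fpl_expMeasure_eq]
  exact withDensity_absolutelyContinuous _ _ (by simp)

lemma fpl_stab {Ω : Type} [MeasurableSpace Ω] (P : Measure Ω) [IsProbabilityMeasure P]
    (n : ℕ) (η : ℝ) (hη : 0 < η) (r0 : Ω → Fin n → ℝ)
    (hdist : ∀ a, Measure.map (fun ω => r0 ω a) P = expMeasure η)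
    (hindep : iIndepFun (fun a ω => r0 ω a) P) (hae : ∀ a, AEMeasurable (fun ω => r0 ω a) P)
    (a : Fin n) (c : Fin n → ℝ) (δ : ℝ) (hδ : 0 ≤ δ) :
    P {ω | ∀ b, b ≠ a → r0 ω b + c b ≤ r0 ω a + δ} ≤
      ENNReal.ofReal (Real.exp (η * δ)) * P {ω | ∀ b, b ≠ a → r0 ω b + c b < r0 ω a} := by
  have := isProbabilityMeasure_expMeasure hη
  have hI := hindep.indepFun_finset₀ {a} (Finset.univ.erase a) (by simp) hae
  have hI2 : IndepFun (fun ω => r0 ω a)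
      (fun ω (i : (Finset.univ.erase a : Finset (Fin n))) => r0 ω i) P :=
    hI.comp (φ := fun f : (({a} : Finset (Fin n)) → ℝ) => f ⟨a, by simp⟩) (ψ := id)
      (by fun_prop) measurable_id
  have hY : AEMeasurable (fun ω (i : (Finset.univ.erase a : Finset (Fin n))) => r0 ω i) P :=
    aemeasurable_pi_lambda _ fun i => hae i
  have hmap := (indepFun_iff_map_prod_eq_prod_map_map (hae a) hY).1 hI2
  rw [hdist a] at hmap
  set Y := (fun ω (i : (Finset.univ.erase a : Finset (Fin n))) => r0 ω i) with hYdef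
  have : IsProbabilityMeasure (P.map Y) := Measure.isProbabilityMeasure_map hY
  let S1 : Set (ℝ × (↥(Finset.univ.erase a) → ℝ)) :=
    {p | ∀ b, p.2 b + c b ≤ p.1 + δ}
  let S0 : Set (ℝ × (↥(Finset.univ.erase a) → ℝ)) :=
    {p | ∀ b, p.2 b + c b < p.1}
  have hS1 : MeasurableSet S1 := by
    simp only [S1, Set.ofPred_forall]
    exact MeasurableSet.iInter fun b => measurableSet_le (by fun_prop) (by fun_prop)
  have hS0 : MeasurableSet S0 := by
    simp only [S0, Set.ofPred_forall]
    exact MeasurableSet.iInter fun b => measurableSet_lt (by fun_prop) (by fun_prop)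
  have e1 : {ω | ∀ b, b ≠ a → r0 ω b + c b ≤ r0 ω a + δ} = (fun ω => (r0 ω a, Y ω)) ⁻¹' S1 := by
    ext ω; simp [S1, Y]
  have e0 : {ω | ∀ b, b ≠ a → r0 ω b + c b < r0 ω a} = (fun ω => (r0 ω a, Y ω)) ⁻¹' S0 := by
    ext ω; simp [S0, Y]
  rw [e1, e0, ← Measure.map_apply_of_aemeasurable ((hae a).prodMk hY) hS1,
    ← Measure.map_apply_of_aemeasurable ((hae a).prodMk hY) hS0, hmap,
    Measure.prod_apply_symm hS1, Measure.prod_apply_symm hS0, ← lintegral_const_mul]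
  · apply lintegral_mono
    intro y
    let A : Set ℝ := {x | ∀ b, y b + c b ≤ x}
    have hA : MeasurableSet A := by
      simp only [A, Set.ofPred_forall]
      exact MeasurableSet.iInter fun b => measurableSet_le (by fun_prop) (by fun_prop)
    have h1 := fpl_exp_shift η δ hδ A hA
    refine h1.trans ?_
    refine mul_le_mul_right ?_ _
    have hsub : A ⊆ ((fun x => (x, y)) ⁻¹' S0) ∪ ⋃ b, {y b + c b} := by
      intro x hx
      by_cases h : ∃ b, x = y b + c b
      · obtain ⟨b, hb⟩ := h
        exact Or.inr (Set.mem_iUnion.2 ⟨b, hb⟩)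
      · left
        push Not at h
        intro b
        exact lt_of_le_of_ne (hx b) (h b).symm
    calc expMeasure η A ≤ _ := measure_mono hsub
      _ ≤ _ := measure_union_le _ _
      _ = _ := by
        rw [measure_iUnion_null (fun b => fpl_exp_null η _), add_zero]
  · exact measurable_measure_prodMk_right hS0

lemma fpl_integral_fin {Ω : Type} [MeasurableSpace Ω] (P : Measure Ω) [IsProbabilityMeasure P]
    (n : ℕ) (f : Fin n → ℝ) (X : Ω → Fin n) (hX : Measurable X) :
    Integrable (fun ω => f (X ω)) P ∧ ∫ ω, f (X ω) ∂P = ∑ a, f a * P.real (X ⁻¹' {a}) := by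
  have : IsProbabilityMeasure (P.map X) := Measure.isProbabilityMeasure_map hX.aemeasurable
  have hi : Integrable f (P.map X) := Integrable.of_finite
  refine ⟨hi.comp_measurable hX, ?_⟩
  rw [← integral_map hX.aemeasurable hi.aestronglyMeasurable, integral_fintype hi]
  refine Finset.sum_congr rfl fun a _ => ?_
  rw [map_measureReal_apply hX (measurableSet_singleton a), smul_eq_mul, mul_comm]

lemma fpl_step {Ω : Type} [MeasurableSpace Ω] (P : Measure Ω) [IsProbabilityMeasure P]
    (n : ℕ) (η : ℝ) (hη : 0 < η) (r0 : Ω → Fin n → ℝ)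
    (hdist : ∀ a, Measure.map (fun ω => r0 ω a) P = expMeasure η)
    (hindep : iIndepFun (fun a ω => r0 ω a) P) (hae : ∀ a, AEMeasurable (fun ω => r0 ω a) P)
    (L f : Fin n → ℝ) (hf : ∀ a, 0 ≤ f a ∧ f a ≤ 1)
    (X Y : Ω → Fin n) (hX : Measurable X) (hY : Measurable Y)
    (hXm : ∀ ω b, r0 ω b + L b ≤ r0 ω (X ω) + L (X ω))
    (hYm : ∀ ω b, r0 ω b + (L b + f b) ≤ r0 ω (Y ω) + (L (Y ω) + f (Y ω))) :
    ∫ ω, f (Y ω) ∂P ≤ ∫ ω, f (X ω) ∂P + η := by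
  rw [(fpl_integral_fin P n f X hX).2, (fpl_integral_fin P n f Y hY).2]
  have key : ∀ a, Real.exp (-η) * P.real (Y ⁻¹' {a}) ≤ P.real (X ⁻¹' {a}) := by
    intro a
    have h1 := fpl_stab P n η hη r0 hdist hindep hae a (fun b => L b - L a) 1 zero_le_one
    have h2 : P (Y ⁻¹' {a}) ≤ ENNReal.ofReal (Real.exp (η * 1)) * P (X ⁻¹' {a}) := by
      refine (measure_mono ?_).trans (h1.trans ?_)
      · intro ω hω b _
        have hω' : Y ω = a := hω
        have h := hYm ω b
        rw [hω'] at h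
        have := (hf a).2
        have := (hf b).1
        linarith
      · gcongr
        intro ω hω
        by_contra hne
        have hne' : X ω ≠ a := hne
        have := hω (X ω) hne'
        have := hXm ω a
        linarith
    have h3 := ENNReal.toReal_mono (by finiteness) h2
    rw [ENNReal.toReal_mul, ENNReal.toReal_ofReal (Real.exp_pos _).le, mul_one] at h3
    change P.real _ ≤ _ * P.real _ at h3
    calc Real.exp (-η) * P.real (Y ⁻¹' {a})
        ≤ Real.exp (-η) * (Real.exp η * P.real (X ⁻¹' {a})) := by gcongr
      _ = P.real (X ⁻¹' {a}) := by rw [← mul_assoc, ← Real.exp_add]; simp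
  have hsum : ∑ a, P.real (Y ⁻¹' {a}) = 1 := by
    have := (fpl_integral_fin P n (fun _ => 1) Y hY).2
    simpa using this.symm
  have he : 1 - η ≤ Real.exp (-η) := by
    have := Real.add_one_le_exp (-η); linarith
  calc ∑ a, f a * P.real (Y ⁻¹' {a})
      ≤ ∑ a, (f a * P.real (X ⁻¹' {a}) + η * P.real (Y ⁻¹' {a})) := by
        refine Finset.sum_le_sum fun a _ => ?_
        have hq : 0 ≤ P.real (Y ⁻¹' {a}) := measureReal_nonneg
        have h0 : (1 - η) * P.real (Y ⁻¹' {a}) ≤ P.real (X ⁻¹' {a}) :=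
          (mul_le_mul_of_nonneg_right he hq).trans (key a)
        have h1 := mul_le_mul_of_nonneg_left h0 (hf a).1
        have h2 := mul_le_mul_of_nonneg_right (hf a).2 (mul_nonneg hη.le hq)
        nlinarith
    _ = _ := by rw [Finset.sum_add_distrib, ← Finset.mul_sum, hsum, mul_one]

lemma fpl_excess {Ω : Type} [MeasurableSpace Ω] (P : Measure Ω)
    (η c : ℝ) (hη : 0 < η) (hc : 0 ≤ c) (X : Ω → ℝ)
    (hdist : Measure.map X P = expMeasure η) (hX : AEMeasurable X P) :
    Integrable (fun ω => max (X ω - c) 0) P ∧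
      ∫ ω, max (X ω - c) 0 ∂P = Real.exp (-(η * c)) / η := by
  have h := fpl_exp_excess η c hη hc
  rw [← hdist, lintegral_map' (by fun_prop) hX] at h
  have hm : AEStronglyMeasurable (fun ω => max (X ω - c) 0) P :=
    ((hX.sub_const c).max aemeasurable_const).aestronglyMeasurable
  have hnn : 0 ≤ᵐ[P] (fun ω => max (X ω - c) 0) :=
    Filter.Eventually.of_forall fun ω => le_max_right _ _
  constructor
  · refine ⟨hm, ?_⟩
    rw [hasFiniteIntegral_iff_ofReal hnn, h]
    exact ENNReal.ofReal_lt_top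
  · rw [integral_eq_lintegral_of_nonneg_ae hnn hm, h, ENNReal.toReal_ofReal (by positivity)]



/-- FPL for the experts problem with `n` experts, run with
`η = √((1 + ln n)/T)`: sample `r₀(a)` i.i.d. from `Exp(η)` for each expert `a`, and in
round `t` play `a_t = argmax_a (r₀(a) + Σ_{τ=1}^{t−1} ℓ_τ(a))`.  Then for any adversarially
chosen reward vectors `ℓ_1, …, ℓ_T ∈ [0,1]^n`, the expected regret satisfies
`max_a Σ_{t=1}^T ℓ_t(a) − E[Σ_{t=1}^T ℓ_t(a_t)] ≤ 2 √((1 + ln n) T)`. -/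
theorem fpl_experts_regret
    {Ω : Type} [MeasurableSpace Ω] (P : Measure Ω) [IsProbabilityMeasure P]
    (n T : ℕ) (hn : 0 < n) (hT : 0 < T)
    (η : ℝ) (hη : η = Real.sqrt ((1 + Real.log n) / T))
    (ℓ : ℕ → Fin n → ℝ) (hℓ : ∀ t a, 0 ≤ ℓ t a ∧ ℓ t a ≤ 1)
    (r0 : Ω → Fin n → ℝ)
    (hdist : ∀ a, Measure.map (fun ω => r0 ω a) P = expMeasure η)
    (hindep : iIndepFun (fun a ω => r0 ω a) P)
    (aT : ℕ → Ω → Fin n)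
    (hmeas : ∀ t, Measurable (aT t))
    (hargmax : ∀ t ω b, r0 ω b + ∑ τ ∈ Finset.Icc 1 (t - 1), ℓ τ b
        ≤ r0 ω (aT t ω) + ∑ τ ∈ Finset.Icc 1 (t - 1), ℓ τ (aT t ω)) :
    ∀ a : Fin n,
      ∑ t ∈ Finset.Icc 1 T, ℓ t a - ∫ ω, ∑ t ∈ Finset.Icc 1 T, ℓ t (aT t ω) ∂P
        ≤ 2 * Real.sqrt ((1 + Real.log n) * T) := by
  intro a
  have hn1 : (1:ℝ) ≤ n := by exact_mod_cast hn
  have hT0 : (0:ℝ) < T := by exact_mod_cast hT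
  have hlog : 0 ≤ Real.log n := Real.log_nonneg hn1
  have hη0 : 0 < η := by rw [hη]; positivity
  have : IsProbabilityMeasure (expMeasure η) := isProbabilityMeasure_expMeasure hη0
  have hae : ∀ a, AEMeasurable (fun ω => r0 ω a) P := by
    intro a
    by_contra hcon
    have h := hdist a
    rw [Measure.map_of_not_aemeasurable hcon] at h
    exact IsProbabilityMeasure.ne_zero (expMeasure η) h.symm
  -- be the leader
  have btl : ∀ ω k, r0 ω (aT (k + 1) ω) + ∑ τ ∈ Finset.Icc 1 k, ℓ τ (aT (k + 1) ω)
      ≤ r0 ω (aT 1 ω) + ∑ t ∈ Finset.Icc 1 k, ℓ t (aT (t + 1) ω) := by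
    intro ω k
    induction k with
    | zero => simp
    | succ k ih =>
      have h := hargmax (k + 1) ω (aT (k + 1 + 1) ω)
      simp only [Nat.add_sub_cancel] at h
      rw [Finset.sum_Icc_succ_top (by lia), Finset.sum_Icc_succ_top (by lia)]
      linarith
  have hint : ∀ t s, Integrable (fun ω => ℓ t (aT s ω)) P := fun t s =>
    (fpl_integral_fin P n (ℓ t) (aT s) (hmeas s)).1
  -- stability
  have stab : ∀ t ∈ Finset.Icc 1 T,
      ∫ ω, ℓ t (aT (t + 1) ω) ∂P ≤ ∫ ω, ℓ t (aT t ω) ∂P + η := by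
    intro t ht
    obtain ⟨k, rfl⟩ : ∃ k, t = k + 1 := ⟨t - 1, by simp at ht; lia⟩
    refine fpl_step P n η hη0 r0 hdist hindep hae (fun b => ∑ τ ∈ Finset.Icc 1 k, ℓ τ b)
      (ℓ (k + 1)) (hℓ (k + 1)) _ _ (hmeas _) (hmeas _) ?_ ?_
    · intro ω b
      simpa using hargmax (k + 1) ω b
    · intro ω b
      have h := hargmax (k + 1 + 1) ω b
      rw [Nat.add_sub_cancel, Finset.sum_Icc_succ_top (by lia),
        Finset.sum_Icc_succ_top (by lia)] at h
      exact h
  set c := Real.log n / η with hc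
  have hc0 : 0 ≤ c := by positivity
  have hex : ∀ b, Integrable (fun ω => max (r0 ω b - c) 0) P ∧
      ∫ ω, max (r0 ω b - c) 0 ∂P = 1 / (n * η) := by
    intro b
    have h := fpl_excess P η c hη0 hc0 (fun ω => r0 ω b) (hdist b) (hae b)
    refine ⟨h.1, h.2.trans ?_⟩
    rw [hc, mul_div_cancel₀ _ hη0.ne', Real.exp_neg, Real.exp_log (by linarith)]
    field_simp
  have hnn : ∀ᵐ ω ∂P, 0 ≤ r0 ω a := by
    have h := fpl_exp_nonneg η hη0
    rw [← hdist a] at h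
    exact ae_of_ae_map (hae a) h
  have hbtl : ∀ᵐ ω ∂P, ∑ t ∈ Finset.Icc 1 T, ℓ t a ≤
      (c + ∑ b, max (r0 ω b - c) 0) + ∑ t ∈ Finset.Icc 1 T, ℓ t (aT (t + 1) ω) := by
    filter_upwards [hnn] with ω hω
    have h1 := btl ω T
    have h2 := hargmax (T + 1) ω a
    rw [Nat.add_sub_cancel] at h2
    have h3 : max (r0 ω (aT 1 ω) - c) 0 ≤ ∑ b, max (r0 ω b - c) 0 :=
      Finset.single_le_sum (f := fun b => max (r0 ω b - c) 0)
        (fun b _ => le_max_right _ _) (Finset.mem_univ _)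
    have h4 := le_max_left (r0 ω (aT 1 ω) - c) 0
    linarith
  have hi1 : Integrable (fun ω => ∑ b, max (r0 ω b - c) 0) P :=
    integrable_finsetSum _ fun b _ => (hex b).1
  have hi2 : Integrable (fun ω => ∑ t ∈ Finset.Icc 1 T, ℓ t (aT (t + 1) ω)) P :=
    integrable_finsetSum _ fun t _ => hint t (t + 1)
  have hi3 : Integrable (fun ω => c + ∑ b, max (r0 ω b - c) 0) P :=
    (integrable_const c).add hi1
  have hI := integral_mono_ae (integrable_const (∑ t ∈ Finset.Icc 1 T, ℓ t a)) (hi3.add hi2) hbtl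
  simp only [Pi.add_apply] at hI
  rw [integral_add hi3 hi2, integral_add (integrable_const c) hi1,
    integral_finsetSum _ (fun b _ => (hex b).1),
    integral_finsetSum _ (fun t _ => hint t (t + 1))] at hI
  simp only [integral_const, probReal_univ, one_smul, (hex _).2, Finset.sum_const,
    Finset.card_univ, Fintype.card_fin, nsmul_eq_mul] at hI
  have hS := Finset.sum_le_sum stab
  rw [Finset.sum_add_distrib] at hS
  simp only [Finset.sum_const, Nat.card_Icc, Nat.add_sub_cancel, nsmul_eq_mul] at hS
  rw [integral_finsetSum _ (fun t _ => hint t t)]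
  have e1 : (n:ℝ) * (1 / (n * η)) = 1 / η := by field_simp
  rw [e1] at hI
  have hsq : η * η * T = 1 + Real.log n := by
    rw [hη, Real.mul_self_sqrt (by positivity)]; field_simp
  have e2 : c + 1 / η = T * η := by
    rw [hc, ← add_div, add_comm, ← hsq]; field_simp
  have e3 : Real.sqrt ((1 + Real.log n) * T) = T * η := by
    rw [← hsq, show η * η * T * T = (T * η) ^ 2 by ring, Real.sqrt_sq (by positivity)]
  rw [e3]
  linarith
end

section
/- Under the FPOP algorithm with parameter η > 0, for every episode t, state s, layer h and action a, the probabilities (over the current epoch's random perturbation r_0) of the actions selected by extended value iteration satisfy Pr[π̂_t(s,h) = a] / Pr[π_t(s,h) = a] ∈ [e^{−ηH}, e^{ηH}]. -/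
open MeasureTheory ProbabilityTheory

section EVI

variable {S A : Type} [Fintype S] [Fintype A]

/-- Validity of a transition kernel given as a function `S → A → S → ℝ`. -/
def IsKernel (p : S → A → S → ℝ) : Prop :=
  (∀ s a s', 0 ≤ p s a s') ∧ ∀ s a, ∑ s' : S, p s a s' = 1

/-- `polValL p r π n h s`: expected reward of the deterministic policy `π` over `n` steps
starting at state `s` in layer `h`, in the MDP with (possibly layer-dependent) transition
kernel `p` and reward `r`.  The value `W(r, π, P, s)` of the paper is
`polValL P r π H 1 s`. -/
noncomputable def polValL (p : ℕ → S → A → S → ℝ) (r : S → A → ℕ → ℝ) (π : S → ℕ → A) :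
    ℕ → ℕ → S → ℝ
  | 0, _, _ => 0
  | n + 1, h, s =>
      r s (π s h) h + ∑ s' : S, p h s (π s h) s' * polValL p r π n (h + 1) s'

/-- `evi 𝒞 r n h s`: the optimistic value computed by extended value iteration, where at
every step the next-state distribution is chosen optimistically from the confidence set
`𝒞 s a`:  `w_h(s) = max_a max_{P ∈ 𝒞(s,a)} (r(s,a,h) + Σ_{s'} P(s') w_{h+1}(s'))`. -/
noncomputable def evi [Nonempty A] (𝒞 : S → A → Set (S → ℝ)) (r : S → A → ℕ → ℝ) :
    ℕ → ℕ → S → ℝ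
  | 0, _, _ => 0
  | n + 1, h, s =>
      ⨆ a : A, ⨆ P ∈ 𝒞 s a, (r s a h + ∑ s' : S, P s' * evi 𝒞 r n (h + 1) s')

/-- `(π, P)` is a solution of extended value iteration for reward `r`, horizon `H` and
confidence sets `𝒞`: the (layer-dependent) optimistic kernel lies in the confidence set,
and the pair attains the optimistic value at every state and layer.  This is exactly what
extended value iteration produces. -/
def EVIConsistent [Nonempty A] (𝒞 : S → A → Set (S → ℝ)) (r : S → A → ℕ → ℝ) (H : ℕ)
    (π : S → ℕ → A) (P : ℕ → S → A → S → ℝ) : Prop :=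
  (∀ h s a, (fun s' => P h s a s') ∈ 𝒞 s a) ∧
  ∀ h s, 1 ≤ h → h ≤ H → polValL P r π (H + 1 - h) h s = evi 𝒞 r (H + 1 - h) h s

end EVI

section Helpers

variable {S A : Type} [Fintype S] [Fintype A]

lemma fh_bound (C : Set (S → ℝ))
    (hC : ∀ Q ∈ C, (∀ s', 0 ≤ Q s') ∧ ∑ s' : S, Q s' = 1) (w : S → ℝ) {Q : S → ℝ} (hQ : Q ∈ C) :
    ∑ s', Q s' * w s' ≤ ∑ s', |w s'| := by
  obtain ⟨h0, h1⟩ := hC Q hQ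
  apply Finset.sum_le_sum
  intro i _
  have h2 : Q i ≤ 1 := by
    rw [← h1]; exact Finset.single_le_sum (fun j _ => h0 j) (Finset.mem_univ i)
  calc Q i * w i ≤ Q i * |w i| := mul_le_mul_of_nonneg_left (le_abs_self _) (h0 i)
    _ ≤ 1 * |w i| := mul_le_mul_of_nonneg_right h2 (abs_nonneg _)
    _ = |w i| := one_mul _

lemma fh_shift (C : Set (S → ℝ))
    (hC : ∀ Q ∈ C, (∀ s', 0 ≤ Q s') ∧ ∑ s' : S, Q s' = 1) (w w' : S → ℝ) (c : ℝ)
    (hw : ∀ s, w' s ≤ w s + c) {Q : S → ℝ} (hQ : Q ∈ C) :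
    ∑ s', Q s' * w' s' ≤ ∑ s', Q s' * w s' + c := by
  obtain ⟨h0, h1⟩ := hC Q hQ
  calc ∑ s', Q s' * w' s' ≤ ∑ s', (Q s' * w s' + Q s' * c) := by
        apply Finset.sum_le_sum
        intro i _
        rw [← mul_add]
        exact mul_le_mul_of_nonneg_left (hw i) (h0 i)
    _ = _ := by rw [Finset.sum_add_distrib, ← Finset.sum_mul, h1, one_mul]

/-- optimistic continuation value -/
noncomputable def fhU (C : Set (S → ℝ)) (w : S → ℝ) : ℝ := ⨆ Q : C, ∑ s', Q.1 s' * w s'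

lemma fhU_bdd (C : Set (S → ℝ))
    (hC : ∀ Q ∈ C, (∀ s', 0 ≤ Q s') ∧ ∑ s' : S, Q s' = 1) (w : S → ℝ) :
    BddAbove (Set.range fun Q : C => ∑ s', Q.1 s' * w s') := by
  refine ⟨∑ s', |w s'|, ?_⟩
  rintro _ ⟨Q, rfl⟩
  exact fh_bound C hC w Q.2

lemma fhU_shift (C : Set (S → ℝ)) (hne : C.Nonempty)
    (hC : ∀ Q ∈ C, (∀ s', 0 ≤ Q s') ∧ ∑ s' : S, Q s' = 1) (w w' : S → ℝ) (c : ℝ)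
    (hw : ∀ s, w' s ≤ w s + c) : fhU C w' ≤ fhU C w + c := by
  haveI : Nonempty C := hne.to_subtype
  apply ciSup_le
  intro Q
  have := fh_shift C hC w w' c hw Q.2
  have h2 := le_ciSup (fhU_bdd C hC w) Q
  simp only [fhU]
  linarith

lemma fhU_cont (C : Set (S → ℝ)) (hne : C.Nonempty)
    (hC : ∀ Q ∈ C, (∀ s', 0 ≤ Q s') ∧ ∑ s' : S, Q s' = 1) : Continuous (fhU C) := by
  apply LipschitzWith.continuous (K := 1)
  apply LipschitzWith.of_le_add
  intro x y
  apply fhU_shift C hne hC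
  intro s
  have := (le_abs_self (x s - y s)).trans (dist_le_pi_dist x y s)
  linarith

lemma fh_inner_bdd (C : Set (S → ℝ))
    (hC : ∀ Q ∈ C, (∀ s', 0 ≤ Q s') ∧ ∑ s' : S, Q s' = 1) (w : S → ℝ) (x : ℝ) :
    BddAbove (Set.range fun Q : S → ℝ => ⨆ _ : Q ∈ C, (x + ∑ s', Q s' * w s')) := by
  refine ⟨|x| + ∑ s', |w s'|, ?_⟩
  rintro _ ⟨Q, rfl⟩
  have h0 : 0 ≤ |x| + ∑ s', |w s'| := by positivity
  by_cases hQ : Q ∈ C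
  · simp only [hQ, ciSup_unique]
    exact add_le_add (le_abs_self x) (fh_bound C hC w hQ)
  · simp only [hQ, Real.iSup_of_isEmpty]
    exact h0

lemma fh_inner_shift (C : Set (S → ℝ))
    (hC : ∀ Q ∈ C, (∀ s', 0 ≤ Q s') ∧ ∑ s' : S, Q s' = 1) (w w' : S → ℝ) (x x' c : ℝ) (hc : 0 ≤ c)
    (hw : ∀ Q ∈ C, x' + ∑ s', Q s' * w' s' ≤ x + ∑ s', Q s' * w s' + c) :
    (⨆ Q ∈ C, (x' + ∑ s', Q s' * w' s')) ≤ (⨆ Q ∈ C, (x + ∑ s', Q s' * w s')) + c := by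
  apply ciSup_le
  intro Q
  have h2 := le_ciSup (fh_inner_bdd C hC w x) Q
  refine le_trans ?_ (add_le_add_left h2 c)
  by_cases hQ : Q ∈ C
  · simp only [hQ, ciSup_unique]
    exact hw Q hQ
  · simp only [hQ, Real.iSup_of_isEmpty]
    linarith

lemma fh_evi_shift [Nonempty A] (C : S → A → Set (S → ℝ))
    (hC : ∀ s a, ∀ Q ∈ C s a, (∀ s', 0 ≤ Q s') ∧ ∑ s' : S, Q s' = 1)
    (ρ ρ' : S → A → ℕ → ℝ) (c : ℝ) (hc : 0 ≤ c) (n : ℕ) :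
    ∀ h, (∀ s a h', h ≤ h' → h' < h + n → ρ' s a h' ≤ ρ s a h' + c) →
    ∀ s, evi C ρ' n h s ≤ evi C ρ n h s + n * c := by
  induction n with
  | zero => intro h _ s; simp [evi]
  | succ n ih =>
    intro h hρ s
    have ih' := ih (h + 1) (fun s a h' h1 h2 => hρ s a h' (by omega) (by omega))
    simp only [evi]
    apply ciSup_le
    intro a
    refine le_trans ?_ (add_le_add_left (le_ciSup (Set.finite_range _).bddAbove a) _)
    apply fh_inner_shift _ (hC s a) _ _ _ _ _ (by positivity)
    intro Q hQ
    have h1 := fh_shift (C s a) (hC s a) _ _ _ ih' hQ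
    have h2 := hρ s a h le_rfl (by omega)
    push_cast
    linarith

/-- The EVI policy is greedy. -/
lemma fh_greedy [Nonempty A] (C : S → A → Set (S → ℝ)) (hne : ∀ s a, (C s a).Nonempty)
    (hC : ∀ s a, ∀ Q ∈ C s a, (∀ s', 0 ≤ Q s') ∧ ∑ s' : S, Q s' = 1)
    (ρ : S → A → ℕ → ℝ) (H : ℕ) (π : S → ℕ → A) (P : ℕ → S → A → S → ℝ)
    (hE : EVIConsistent C ρ H π P) (h : ℕ) (h1 : 1 ≤ h) (hH : h ≤ H) (s : S) (a' : A) :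
    ρ s a' h + fhU (C s a') (evi C ρ (H - h) (h + 1)) ≤
      ρ s (π s h) h + fhU (C s (π s h)) (evi C ρ (H - h) (h + 1)) := by
  obtain ⟨hP, hV⟩ := hE
  have e1 := hV h s h1 hH
  have e2 : ∀ s', polValL P ρ π (H - h) (h + 1) s' = evi C ρ (H - h) (h + 1) s' := by
    intro s'
    rcases Nat.lt_or_ge h H with hlt | hge
    · have := hV (h + 1) s' (by omega) (by omega)
      rwa [show H + 1 - (h + 1) = H - h by omega] at this
    · rw [show H - h = 0 by omega]; simp [evi, polValL]
  rw [show H + 1 - h = (H - h) + 1 by omega] at e1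
  have up : evi C ρ (H - h + 1) h s ≤
      ρ s (π s h) h + fhU (C s (π s h)) (evi C ρ (H - h) (h + 1)) := by
    rw [← e1]
    simp only [polValL, e2]
    exact add_le_add_right (le_ciSup (fhU_bdd _ (hC s _) (evi C ρ (H - h) (h + 1)))
      ⟨_, hP h s (π s h)⟩) _
  refine le_trans ?_ up
  haveI : Nonempty (C s a') := (hne s a').to_subtype
  rw [← le_sub_iff_add_le']
  apply ciSup_le
  intro Q
  rw [le_sub_iff_add_le']
  simp only [evi]
  refine le_trans ?_ (le_ciSup (Set.finite_range _).bddAbove a')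
  refine le_trans ?_ (le_ciSup (fh_inner_bdd _ (hC s a') _ _) Q.1)
  simp only [Q.2, ciSup_unique, le_refl]

lemma fh_exp_shift (η : ℝ) (hη : 0 < η) (k : ℝ) (hk : 0 ≤ k) (E : Set ℝ) (hE : MeasurableSet E) :
    expMeasure η {x | x + k ∈ E} ≤ ENNReal.ofReal (Real.exp (η * k)) * expMeasure η E := by
  have hm : MeasurableSet {x | x + k ∈ E} := (measurable_add_const k) hE
  have hd : ∀ F : Set ℝ, MeasurableSet F →
      expMeasure η F = ∫⁻ x, F.indicator (exponentialPDF η) x := by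
    intro F hF
    rw [lintegral_indicator hF]
    exact withDensity_apply _ hF
  rw [hd _ hm, hd _ hE, ← lintegral_const_mul' _ _ ENNReal.ofReal_ne_top,
    ← lintegral_add_right_eq_self (fun x => ENNReal.ofReal (Real.exp (η * k)) *
      E.indicator (exponentialPDF η) x) k]
  apply lintegral_mono
  intro x
  by_cases hx : x + k ∈ E
  · have hx' : x ∈ {x | x + k ∈ E} := hx
    simp only [Set.indicator_of_mem hx, Set.indicator_of_mem hx', exponentialPDF_eq]
    by_cases h0 : 0 ≤ x
    · rw [if_pos h0, if_pos (by linarith), ← ENNReal.ofReal_mul (Real.exp_pos _).le]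
      apply ENNReal.ofReal_le_ofReal
      apply le_of_eq
      rw [mul_left_comm, ← Real.exp_add]
      congr 2
      ring
    · rw [if_neg h0]; simp
  · have hx' : x ∉ {x | x + k ∈ E} := hx
    simp [Set.indicator_of_notMem hx']

lemma fh_pi_update {ι : Type} [Fintype ι] [DecidableEq ι] (μ : Measure ℝ)
    [IsProbabilityMeasure μ] (i : ι) :
    Measure.map (fun p : ℝ × (ι → ℝ) => Function.update p.2 i p.1)
      (μ.prod (Measure.pi fun _ : ι => μ)) = Measure.pi fun _ : ι => μ := by
  symm
  apply Measure.pi_eq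
  intro s hs
  have hmeas : Measurable (fun p : ℝ × (ι → ℝ) => Function.update p.2 i p.1) := by
    rw [measurable_pi_iff]
    intro j
    by_cases hj : j = i
    · subst hj; simpa using measurable_fst
    · simp only [Function.update_of_ne hj]; fun_prop
  rw [Measure.map_apply hmeas (MeasurableSet.univ_pi hs)]
  have : (fun p : ℝ × (ι → ℝ) => Function.update p.2 i p.1) ⁻¹' (Set.univ.pi s)
      = s i ×ˢ (Set.univ.pi (Function.update s i Set.univ)) := by
    ext ⟨x, v⟩
    simp only [Set.mem_preimage, Set.mem_pi, Set.mem_univ, true_imp_iff, Set.mem_prod]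
    constructor
    · intro h
      refine ⟨by simpa using h i, fun j => ?_⟩
      by_cases hj : j = i
      · subst hj; simp
      · simpa [Function.update_of_ne hj] using h j
    · rintro ⟨h1, h2⟩ j
      by_cases hj : j = i
      · subst hj; simpa using h1
      · simpa [Function.update_of_ne hj] using h2 j
  rw [this, Measure.prod_prod, Measure.pi_pi, ← Finset.mul_prod_erase _ _ (Finset.mem_univ i),
    ← Finset.mul_prod_erase Finset.univ (fun j => μ (s j)) (Finset.mem_univ i)]
  simp only [Function.update_self, measure_univ, one_mul]
  congr 1
  apply Finset.prod_congr rfl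
  intro j hj
  rw [Function.update_of_ne (Finset.ne_of_mem_erase hj)]

lemma fh_pi_shift_gen {ι : Type} [Fintype ι] [DecidableEq ι] (μ : Measure ℝ)
    [IsProbabilityMeasure μ] (i : ι) (k : ℝ) (K : ENNReal) (hK : K ≠ ⊤)
    (hμ : ∀ F : Set ℝ, MeasurableSet F → μ {x | x + k ∈ F} ≤ K * μ F)
    (E : Set (ι → ℝ)) (hE : MeasurableSet E) :
    (Measure.pi fun _ : ι => μ) {v | Function.update v i (v i + k) ∈ E}
      ≤ K * (Measure.pi fun _ : ι => μ) E := by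
  have hmeas : Measurable (fun p : ℝ × (ι → ℝ) => Function.update p.2 i p.1) := by
    rw [measurable_pi_iff]
    intro j
    by_cases hj : j = i
    · subst hj; simpa using measurable_fst
    · simp only [Function.update_of_ne hj]; fun_prop
  have hm1 : Measurable (fun v : ι → ℝ => (v i + k, v)) := by fun_prop
  have hm2 : Measurable (fun v : ι → ℝ => Function.update v i (v i + k)) := hmeas.comp hm1
  have hE2 : MeasurableSet {v | Function.update v i (v i + k) ∈ E} := hm2 hE
  have e : ∀ F : Set (ι → ℝ), MeasurableSet F → (Measure.pi fun _ : ι => μ) F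
      = ∫⁻ v, μ {x | Function.update v i x ∈ F} ∂(Measure.pi fun _ : ι => μ) := by
    intro F hF
    conv_lhs => rw [← fh_pi_update μ i]
    rw [Measure.map_apply hmeas hF, Measure.prod_apply_symm (hmeas hF)]
    rfl
  rw [e _ hE2, e _ hE, ← lintegral_const_mul' _ _ hK]
  apply lintegral_mono
  intro v
  have hmv0 : Measurable (fun x : ℝ => (x, v)) := by fun_prop
  have hmv : Measurable (fun x : ℝ => Function.update v i x) := hmeas.comp hmv0
  have h3 := hμ {x | Function.update v i x ∈ E} (hmv hE)
  simpa using h3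

lemma fh_pi_shift {ι : Type} [Fintype ι] [DecidableEq ι] (η : ℝ) (hη : 0 < η) (i : ι)
    (k : ℝ) (hk : 0 ≤ k) (E : Set (ι → ℝ)) (hE : MeasurableSet E) :
    (Measure.pi fun _ : ι => expMeasure η) {v | Function.update v i (v i + k) ∈ E}
      ≤ ENNReal.ofReal (Real.exp (η * k)) * (Measure.pi fun _ : ι => expMeasure η) E := by
  have : IsProbabilityMeasure (expMeasure η) := isProbabilityMeasure_expMeasure hη
  exact fh_pi_shift_gen (expMeasure η) i k _ ENNReal.ofReal_ne_top
    (fun F hF => fh_exp_shift η hη k hk F hF) E hE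

/-- the reward function obtained from a perturbation vector and a fixed offset -/
noncomputable def fhR (H : ℕ) (G : S → A → ℕ → ℝ) (v : S × A × Fin H → ℝ) : S → A → ℕ → ℝ :=
  fun s a h => (if hh : 1 ≤ h ∧ h ≤ H then v (s, a, ⟨h - 1, by omega⟩) else 0) + G s a h

lemma fhR_eq (H : ℕ) (G : S → A → ℕ → ℝ) (v : S × A × Fin H → ℝ) (s : S) (a : A) (h : ℕ)
    (h1 : 1 ≤ h) (h2 : h ≤ H) : fhR H G v s a h = v (s, a, ⟨h - 1, by omega⟩) + G s a h := by
  simp [fhR, h1, h2]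

lemma fh_evi_cont [Nonempty A] (C : S → A → Set (S → ℝ))
    (hC : ∀ s a, ∀ Q ∈ C s a, (∀ s', 0 ≤ Q s') ∧ ∑ s' : S, Q s' = 1)
    (H : ℕ) (G : S → A → ℕ → ℝ) (n h : ℕ) :
    Continuous (fun v : S × A × Fin H → ℝ => evi C (fhR H G v) n h) := by
  apply continuous_pi
  intro s
  apply LipschitzWith.continuous (K := (n : NNReal))
  apply LipschitzWith.of_le_add_mul
  intro x y
  apply fh_evi_shift C hC _ _ _ dist_nonneg
  intro s a h' _ _
  by_cases hh : 1 ≤ h' ∧ h' ≤ H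
  · rw [fhR_eq _ _ _ _ _ _ hh.1 hh.2, fhR_eq _ _ _ _ _ _ hh.1 hh.2]
    have := (le_abs_self _).trans (dist_le_pi_dist x y (s, a, ⟨h' - 1, by omega⟩))
    linarith
  · simp only [fhR, hh, dite_false]
    linarith [dist_nonneg (x := x) (y := y)]

lemma fh_core [Nonempty A]
    {Ω : Type} [MeasurableSpace Ω] (P : Measure Ω) [IsProbabilityMeasure P]
    (H : ℕ) (η : ℝ) (hη : 0 < η) (C : S → A → Set (S → ℝ)) (hne : ∀ s a, (C s a).Nonempty)
    (hC : ∀ s a, ∀ Q ∈ C s a, (∀ s', 0 ≤ Q s') ∧ ∑ s' : S, Q s' = 1)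
    (G1 G2 : S → A → ℕ → ℝ) (c1 c2 : ℝ) (hc1 : 0 ≤ c1) (hc2 : 0 ≤ c2) (hc : c1 + c2 = 1)
    (hG1 : ∀ s a h, G1 s a h ≤ G2 s a h + c1) (hG2 : ∀ s a h, G2 s a h ≤ G1 s a h + c2)
    (R0 : Ω → S → A → ℕ → ℝ)
    (hdist : ∀ s a h, 1 ≤ h → h ≤ H → Measure.map (fun ω => R0 ω s a h) P = expMeasure η)
    (hindep : iIndepFun (fun (x : S × A × Fin H) ω => R0 ω x.1 x.2.1 (x.2.2.val + 1)) P)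
    (π1 π2 : Ω → S → ℕ → A) (P1 P2 : Ω → ℕ → S → A → S → ℝ)
    (hπ1 : ∀ ω, EVIConsistent C (fun s a h => R0 ω s a h + G1 s a h) H (π1 ω) (P1 ω))
    (hπ2 : ∀ ω, EVIConsistent C (fun s a h => R0 ω s a h + G2 s a h) H (π2 ω) (P2 ω))
    (s : S) (h : ℕ) (a : A) (h1 : 1 ≤ h) (hH : h ≤ H) :
    (P {ω | π2 ω s h = a}).toReal ≤ Real.exp (η * H) * (P {ω | π1 ω s h = a}).toReal := by
  classical
  haveI : IsProbabilityMeasure (expMeasure η) := isProbabilityMeasure_expMeasure hη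
  -- the perturbation vector and its law
  let V : Ω → (S × A × Fin H → ℝ) := fun ω x => R0 ω x.1 x.2.1 (x.2.2.val + 1)
  have hae : ∀ x : S × A × Fin H, AEMeasurable (fun ω => R0 ω x.1 x.2.1 (x.2.2.val + 1)) P := by
    intro x
    apply AEMeasurable.of_map_ne_zero
    rw [hdist _ _ _ (by omega) (by omega)]
    exact IsProbabilityMeasure.ne_zero _
  have hV : AEMeasurable V P := aemeasurable_pi_lambda _ hae
  have hlaw : Measure.map V P = Measure.pi fun _ => expMeasure η := by
    rw [(iIndepFun_iff_map_fun_eq_pi_map hae).1 hindep]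
    congr 1
    funext x
    exact hdist _ _ _ (by omega) (by omega)
  -- rewards agree with those from the vector
  have hrew : ∀ (G : S → A → ℕ → ℝ) ω s a h', 1 ≤ h' → h' ≤ H →
      fhR H G (V ω) s a h' = R0 ω s a h' + G s a h' := by
    intro G ω s a h' h1 h2
    rw [fhR_eq _ _ _ _ _ _ h1 h2]
    simp only [V]
    rw [Nat.sub_add_cancel h1]
  have hevi : ∀ (G : S → A → ℕ → ℝ) ω, evi C (fhR H G (V ω)) (H - h) (h + 1)
      = evi C (fun s a h => R0 ω s a h + G s a h) (H - h) (h + 1) := by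
    intro G ω
    funext s'
    apply le_antisymm
    · have := fh_evi_shift C hC (fun s a h => R0 ω s a h + G s a h) (fhR H G (V ω)) 0 le_rfl
        (H - h) (h + 1) (fun s a h' ha hb => by
          rw [hrew G ω s a h' (by omega) (by omega), add_zero]) s'
      simpa using this
    · have := fh_evi_shift C hC (fhR H G (V ω)) (fun s a h => R0 ω s a h + G s a h) 0 le_rfl
        (H - h) (h + 1) (fun s a h' ha hb => by
          rw [hrew G ω s a h' (by omega) (by omega), add_zero]) s'
      simpa using this
  -- optimistic Q-values
  let q : (S → A → ℕ → ℝ) → (S × A × Fin H → ℝ) → A → ℝ := fun G v b =>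
    v (s, b, ⟨h - 1, by omega⟩) + G s b h + fhU (C s b) (evi C (fhR H G v) (H - h) (h + 1))
  have hq : ∀ G, ∀ b, Continuous fun v => q G v b := by
    intro G b
    have := (fhU_cont (C s b) (hne s b) (hC s b)).comp (fh_evi_cont C hC H G (H - h) (h + 1))
    exact ((continuous_apply _).add continuous_const).add this
  have hgr : ∀ (G : S → A → ℕ → ℝ) ω π p,
      EVIConsistent C (fun s a h => R0 ω s a h + G s a h) H π p →
      ∀ b, q G (V ω) b ≤ q G (V ω) (π s h) := by
    intro G ω π p hE b
    have := fh_greedy C hne hC _ H π p hE h h1 hH s b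
    simp only [← hevi, ← hrew G ω s _ h h1 hH] at this
    simp only [fhR_eq H G _ s _ h h1 hH] at this
    exact this
  let E : Set (S × A × Fin H → ℝ) := {v | ∀ b, b ≠ a → q G1 v b < q G1 v a}
  have hE : MeasurableSet E := by
    have : E = ⋂ b, ⋂ (_ : b ≠ a), {v | q G1 v b < q G1 v a} := by ext; simp [E]
    rw [this]
    exact MeasurableSet.iInter fun b => MeasurableSet.iInter fun _ =>
      measurableSet_lt (hq G1 b).measurable (hq G1 a).measurable
  have hE1 : P (V ⁻¹' E) ≤ P {ω | π1 ω s h = a} := by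
    apply measure_mono
    intro ω hω
    by_contra hcon
    have h2 := hω _ hcon
    have h3 := hgr G1 ω _ _ (hπ1 ω) a
    linarith
  have hdiff : ∀ v b, q G1 v b - q G2 v b ≤ H * c1 ∧ q G2 v b - q G1 v b ≤ H * c2 := by
    have gen : ∀ (F F' : S → A → ℕ → ℝ) (c : ℝ), 0 ≤ c → (∀ s a h, F' s a h ≤ F s a h + c) →
        ∀ v b, q F' v b - q F v b ≤ H * c := by
      intro F F' c hc hF v b
      have e := fhU_shift (C s b) (hne s b) (hC s b) _ _ _
        (fh_evi_shift C hC (fhR H F v) (fhR H F' v) c hc (H - h) (h + 1) (fun s a h' _ _ => by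
          simp only [fhR]; linarith [hF s a h']))
      have e2 := hF s b h
      have e3 : ((H - h : ℕ) : ℝ) + 1 ≤ H := by
        have : H - h + 1 ≤ H := by omega
        exact_mod_cast this
      have e4 := mul_le_mul_of_nonneg_right e3 hc
      simp only [q]
      linarith
    exact fun v b => ⟨gen G2 G1 c1 hc1 hG1 v b, gen G1 G2 c2 hc2 hG2 v b⟩
  have hε : ∀ ε : ℝ, 0 < ε → (P {ω | π2 ω s h = a}).toReal
      ≤ Real.exp (η * (H + ε)) * (P {ω | π1 ω s h = a}).toReal := by
    intro ε hε
    let i : S × A × Fin H := (s, a, ⟨h - 1, by omega⟩)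
    have hk : (0 : ℝ) ≤ H + ε := by positivity
    let E' : Set (S × A × Fin H → ℝ) := {v | Function.update v i (v i + (H + ε)) ∈ E}
    have hE' : MeasurableSet E' := by
      have : Continuous fun v : S × A × Fin H → ℝ => Function.update v i (v i + (H + ε)) :=
        continuous_id.update i ((continuous_apply i).add continuous_const)
      exact this.measurable hE
    have hsub : P {ω | π2 ω s h = a} ≤ P (V ⁻¹' E') := by
      apply measure_mono
      intro ω hω b hb
      have g := hgr G2 ω _ _ (hπ2 ω) b
      rw [show π2 ω s h = a from hω] at g
      have hev : evi C (fhR H G1 (Function.update (V ω) i (V ω i + (H + ε)))) (H - h) (h + 1)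
          = evi C (fhR H G1 (V ω)) (H - h) (h + 1) := by
        have hag : ∀ s a h', h + 1 ≤ h' → h' < h + 1 + (H - h) →
            fhR H G1 (Function.update (V ω) i (V ω i + (H + ε))) s a h'
              = fhR H G1 (V ω) s a h' := by
          intro s a h' ha hb
          rw [fhR_eq _ _ _ _ _ _ (by omega) (by omega), fhR_eq _ _ _ _ _ _ (by omega) (by omega),
            Function.update_of_ne]
          intro heq
          have := congrArg (fun z => z.2.2.val) heq
          simp only [i] at this
          omega
        funext s'
        apply le_antisymm
        · simpa using fh_evi_shift C hC _ _ 0 le_rfl (H - h) (h + 1)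
            (fun s a h' ha hb => by rw [hag s a h' ha hb, add_zero]) s'
        · simpa using fh_evi_shift C hC _ _ 0 le_rfl (H - h) (h + 1)
            (fun s a h' ha hb => by rw [hag s a h' ha hb, add_zero]) s'
      have d1 := (hdiff (V ω) b).1
      have d2 := (hdiff (V ω) a).2
      have hsum : (H : ℝ) * c1 + H * c2 = H := by rw [← mul_add, hc, mul_one]
      have qa : q G1 (Function.update (V ω) i (V ω i + (H + ε))) a
          = q G1 (V ω) a + (H + ε) := by
        simp only [q, hev]
        rw [show ((s, a, ⟨h - 1, by omega⟩) : S × A × Fin H) = i from rfl, Function.update_self]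
        ring
      have qb : q G1 (Function.update (V ω) i (V ω i + (H + ε))) b = q G1 (V ω) b := by
        simp only [q, hev]
        rw [Function.update_of_ne]
        intro heq
        exact hb (congrArg (fun z => z.2.1) heq)
      rw [qa, qb]
      linarith
    have main : P {ω | π2 ω s h = a}
        ≤ ENNReal.ofReal (Real.exp (η * (H + ε))) * P {ω | π1 ω s h = a} := by
      calc P {ω | π2 ω s h = a} ≤ P (V ⁻¹' E') := hsub
        _ = Measure.map V P E' := (Measure.map_apply_of_aemeasurable hV hE').symm
        _ ≤ ENNReal.ofReal (Real.exp (η * (H + ε))) * Measure.map V P E := by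
          rw [hlaw]; exact fh_pi_shift η hη i _ hk E hE
        _ = ENNReal.ofReal (Real.exp (η * (H + ε))) * P (V ⁻¹' E) := by
          rw [Measure.map_apply_of_aemeasurable hV hE]
        _ ≤ _ := by gcongr
    have := ENNReal.toReal_mono (ENNReal.mul_ne_top ENNReal.ofReal_ne_top (measure_ne_top _ _)) main
    rwa [ENNReal.toReal_mul, ENNReal.toReal_ofReal (Real.exp_pos _).le] at this
  have hlim : Filter.Tendsto (fun ε : ℝ => Real.exp (η * (H + ε)) * (P {ω | π1 ω s h = a}).toReal)
      (nhdsWithin 0 (Set.Ioi 0)) (nhds (Real.exp (η * H) * (P {ω | π1 ω s h = a}).toReal)) := by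
    have hc : Continuous (fun ε : ℝ => Real.exp (η * (H + ε)) *
      (P {ω | π1 ω s h = a}).toReal) := by fun_prop
    have := hc.tendsto 0
    rw [add_zero] at this
    exact this.mono_left nhdsWithin_le_nhds
  exact ge_of_tendsto hlim (Filter.eventually_of_mem self_mem_nhdsWithin fun ε h => hε ε h)

end Helpers

/-- Under the FPOP algorithm with parameter `η > 0`, for every episode
`t`, state `s`, layer `h` and action `a`, the probabilities (over the current epoch's
random perturbation `r₀`, the confidence set of the current epoch being fixed) of the
actions selected by extended value iteration satisfy
`Pr[π̂_t(s,h) = a] / Pr[π_t(s,h) = a] ∈ [e^{−ηH}, e^{ηH}]`,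
stated here in the equivalent multiplicative (division-free) form. -/
theorem fpop_action_probability_stability
    {S A : Type} [Fintype S] [Fintype A] [Nonempty S] [Nonempty A]
    {Ω : Type} [MeasurableSpace Ω] (P : Measure Ω) [IsProbabilityMeasure P]
    (H T : ℕ) (hH : 0 < H) (hT : 0 < T)
    (η : ℝ) (hη : 0 < η)
    -- the adversarially chosen rewards, with values in [0,1]
    (r : ℕ → S → A → ℕ → ℝ) (hr : ∀ t s a h, 0 ≤ r t s a h ∧ r t s a h ≤ 1)
    -- the confidence sets of the current epoch (fixed, nonempty, compact sets of
    -- probability distributions)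
    (𝒞 : ℕ → S → A → Set (S → ℝ))
    (hne : ∀ t s a, (𝒞 t s a).Nonempty)
    (hcompact : ∀ t s a, IsCompact (𝒞 t s a))
    (hprob : ∀ t s a, ∀ Q ∈ 𝒞 t s a, (∀ s', 0 ≤ Q s') ∧ ∑ s' : S, Q s' = 1)
    -- the current epoch's random perturbation: i.i.d. Exp(η) entries
    (R0 : ℕ → Ω → S → A → ℕ → ℝ)
    (hR0dist : ∀ t s a h, 1 ≤ h → h ≤ H →
      Measure.map (fun ω => R0 t ω s a h) P = expMeasure η)
    (hR0indep : ∀ t, iIndepFun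
      (fun (x : S × A × Fin H) ω => R0 t ω x.1 x.2.1 (x.2.2.val + 1)) P)
    -- (π_t, P̃_t) is the EVI solution for r_{0:t−1}, (π̂_t, P̂_t) the one for r_{0:t}
    (πt πhat : ℕ → Ω → S → ℕ → A)
    (Pt Phat : ℕ → Ω → ℕ → S → A → S → ℝ)
    (hπt : ∀ t ω, EVIConsistent (𝒞 t)
      (fun s a h => R0 t ω s a h + ∑ τ ∈ Finset.Icc 1 (t - 1), r τ s a h) H
      (πt t ω) (Pt t ω))
    (hπhat : ∀ t ω, EVIConsistent (𝒞 t)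
      (fun s a h => R0 t ω s a h + ∑ τ ∈ Finset.Icc 1 t, r τ s a h) H
      (πhat t ω) (Phat t ω))
    (hmeas : ∀ t s h a, MeasurableSet {ω | πt t ω s h = a}
      ∧ MeasurableSet {ω | πhat t ω s h = a}) :
    ∀ t s h a, 1 ≤ t → t ≤ T → 1 ≤ h → h ≤ H →
      (P {ω | πhat t ω s h = a}).toReal
          ≤ Real.exp (η * H) * (P {ω | πt t ω s h = a}).toReal ∧
      (P {ω | πt t ω s h = a}).toReal
          ≤ Real.exp (η * H) * (P {ω | πhat t ω s h = a}).toReal := by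
  intro t s h a ht _ h1 h2
  have hsplit : ∀ s a h, ∑ τ ∈ Finset.Icc 1 t, r τ s a h
      = ∑ τ ∈ Finset.Icc 1 (t - 1), r τ s a h + r t s a h := by
    intro s a h
    obtain ⟨u, rfl⟩ : ∃ u, t = u + 1 := ⟨t - 1, by omega⟩
    rw [Finset.sum_Icc_succ_top (by omega)]
    rfl
  constructor
  · exact fh_core P H η hη (𝒞 t) (hne t) (hprob t) _ _ 0 1 le_rfl zero_le_one (by norm_num)
      (fun s a h => by rw [hsplit]; linarith [(hr t s a h).1])
      (fun s a h => by rw [hsplit]; linarith [(hr t s a h).2])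
      (R0 t) (hR0dist t) (hR0indep t) (πt t) (πhat t) (Pt t) (Phat t) (hπt t) (hπhat t) s h a h1 h2
  · exact fh_core P H η hη (𝒞 t) (hne t) (hprob t) _ _ 1 0 zero_le_one le_rfl (by norm_num)
      (fun s a h => by rw [hsplit]; linarith [(hr t s a h).2])
      (fun s a h => by rw [hsplit]; linarith [(hr t s a h).1])
      (R0 t) (hR0dist t) (hR0indep t) (πhat t) (πt t) (Phat t) (Pt t) (hπhat t) (hπt t) s h a h1 h2
end

section
/- Under the FPOP algorithm, if η ≤ H^{−2}, then for every episode t, E[v̂_t] ≤ E[v̄_t] + (e−1)·η·H³, where v̂_t = W(r_t, π̂_t, P̂_t, s^t_1), v̄_t = W(r_t, π_t, P̂_t, s^t_1), and the expectation is over the algorithm's randomness. -/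
open MeasureTheory ProbabilityTheory

set_option linter.unusedSectionVars false

section FPOPAux

variable {S A : Type} [Fintype S] [Fintype A]

/-! ### Policy values -/

lemma pv_congr (p : ℕ → S → A → S → ℝ) (r r' : S → A → ℕ → ℝ) (π : S → ℕ → A)
    (n : ℕ) : ∀ (h : ℕ) (_ : ∀ k, h ≤ k → k < h + n → ∀ s, r s (π s k) k = r' s (π s k) k) (s : S),
    polValL p r π n h s = polValL p r' π n h s := by
  induction n with
  | zero => intro h _ s; rfl
  | succ n ih =>
    intro h hh s
    simp only [polValL]
    rw [hh h le_rfl (by omega) s]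
    congr 1
    refine Finset.sum_congr rfl fun s' _ => ?_
    rw [ih (h + 1) (fun k hk hk' => hh k (by omega) (by omega))]

lemma pv_add (p : ℕ → S → A → S → ℝ) (r r' : S → A → ℕ → ℝ) (π : S → ℕ → A)
    (n : ℕ) : ∀ (h : ℕ) (s : S),
    polValL p (fun s a k => r s a k + r' s a k) π n h s
      = polValL p r π n h s + polValL p r' π n h s := by
  induction n with
  | zero => intro h s; simp [polValL]
  | succ n ih =>
    intro h s
    simp only [polValL, ih, mul_add, Finset.sum_add_distrib]
    ring

lemma pv_smul (p : ℕ → S → A → S → ℝ) (r : S → A → ℕ → ℝ) (π : S → ℕ → A) (c : ℝ)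
    (n : ℕ) : ∀ (h : ℕ) (s : S),
    polValL p (fun s a k => c * r s a k) π n h s = c * polValL p r π n h s := by
  induction n with
  | zero => intro h s; simp [polValL]
  | succ n ih =>
    intro h s
    simp only [polValL, ih, mul_add, Finset.mul_sum]
    congr 1
    refine Finset.sum_congr rfl fun s' _ => ?_
    ring

lemma pv_sum {ι : Type} (I : Finset ι) (p : ℕ → S → A → S → ℝ) (r : ι → S → A → ℕ → ℝ)
    (π : S → ℕ → A) (n h : ℕ) (s : S) :
    polValL p (fun s a k => ∑ i ∈ I, r i s a k) π n h s = ∑ i ∈ I, polValL p (r i) π n h s := by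
  classical
  induction I using Finset.induction with
  | empty =>
    have := pv_smul p (fun _ _ _ => 0) π 0 n h s
    simpa using this
  | insert i I hi ih =>
    simp only [Finset.sum_insert hi]
    rw [pv_add, ih]

lemma pv_mono (p : ℕ → S → A → S → ℝ) (hp : ∀ h s a s', 0 ≤ p h s a s')
    (r r' : S → A → ℕ → ℝ) (π : S → ℕ → A)
    (n : ℕ) : ∀ (h : ℕ) (_ : ∀ s a k, r s a k ≤ r' s a k) (s : S),
    polValL p r π n h s ≤ polValL p r' π n h s := by
  induction n with
  | zero => intro h _ s; exact le_rfl
  | succ n ih =>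
    intro h hh s
    simp only [polValL]
    refine add_le_add (hh _ _ _) (Finset.sum_le_sum fun s' _ => ?_)
    exact mul_le_mul_of_nonneg_left (ih _ hh _) (hp _ _ _ _)

lemma pv_one (p : ℕ → S → A → S → ℝ) (hp : ∀ h s a, ∑ s', p h s a s' = 1) (π : S → ℕ → A)
    (n : ℕ) : ∀ (h : ℕ) (s : S), polValL p (fun _ _ _ => 1) π n h s = n := by
  induction n with
  | zero => intro h s; simp [polValL]
  | succ n ih =>
    intro h s
    simp only [polValL, ih, ← Finset.sum_mul, hp]
    push_cast; ring

lemma pv_nonneg (p : ℕ → S → A → S → ℝ) (hp : ∀ h s a s', 0 ≤ p h s a s')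
    (r : S → A → ℕ → ℝ) (hr : ∀ s a k, 0 ≤ r s a k) (π : S → ℕ → A) (n h : ℕ) (s : S) :
    0 ≤ polValL p r π n h s := by
  have h0 := pv_smul p (fun _ _ _ => 0) π 0 n h s
  have h1 := pv_mono p hp (fun s a k => 0 * (fun _ _ _ => (0:ℝ)) s a k) r π n h
    (by simpa using hr) s
  rw [h0] at h1
  simpa using h1

lemma pv_le (p : ℕ → S → A → S → ℝ) (hp : ∀ h s a s', 0 ≤ p h s a s')
    (hp1 : ∀ h s a, ∑ s', p h s a s' = 1)
    (r : S → A → ℕ → ℝ) (hr : ∀ s a k, r s a k ≤ 1) (π : S → ℕ → A) (n h : ℕ) (s : S) :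
    polValL p r π n h s ≤ n := by
  rw [← pv_one p hp1 π n h s]
  exact pv_mono p hp _ _ π n h hr s

open Classical in
/-- Performance difference bound. -/
lemma pv_diff (p : ℕ → S → A → S → ℝ) (hp : ∀ h s a s', 0 ≤ p h s a s')
    (hp1 : ∀ h s a, ∑ s', p h s a s' = 1)
    (r : S → A → ℕ → ℝ) (hr : ∀ s a k, 0 ≤ r s a k ∧ r s a k ≤ 1) (π π' : S → ℕ → A) (H : ℕ)
    (n : ℕ) : ∀ (h : ℕ) (s : S), n ≤ H →
    polValL p r π' n h s - polValL p r π n h s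
      ≤ polValL p (fun s a k => if π' s k = a ∧ π s k ≠ a then (H : ℝ) else 0) π' n h s := by
  induction n with
  | zero => intro h s _; simp [polValL]
  | succ n ih =>
    intro h s hn
    by_cases hc : π s h = π' s h
    · simp only [polValL, hc]
      simp only [ne_eq, not_true_eq_false, and_false, if_false]
      rw [add_sub_add_left_eq_sub, ← Finset.sum_sub_distrib, zero_add]
      refine Finset.sum_le_sum fun s' _ => ?_
      rw [← mul_sub]
      exact mul_le_mul_of_nonneg_left (ih _ _ (by omega)) (hp _ _ _ _)
    · have h1 := pv_le p hp hp1 r (fun s a k => (hr s a k).2) π' (n+1) h s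
      have h2 := pv_nonneg p hp r (fun s a k => (hr s a k).1) π (n+1) h s
      have h3 : (H : ℝ) ≤ polValL p
          (fun s a k => if π' s k = a ∧ π s k ≠ a then (H : ℝ) else 0) π' (n+1) h s := by
        rw [polValL]
        rw [if_pos ⟨rfl, hc⟩]
        refine le_add_of_nonneg_right (Finset.sum_nonneg fun s' _ => ?_)
        refine mul_nonneg (hp _ _ _ _) (pv_nonneg p hp _ ?_ _ _ _ _)
        intro s a k
        split_ifs <;> positivity
      have h4 : ((n + 1 : ℕ) : ℝ) ≤ H := by exact_mod_cast hn
      linarith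

/-! ### Clean extended value iteration -/

/-- support function of a set -/
noncomputable def sig (C : Set (S → ℝ)) (w : S → ℝ) : ℝ :=
  sSup ((fun P : S → ℝ => ∑ s', P s' * w s') '' C)

lemma sig_bdd {C : Set (S → ℝ)} (hC : IsCompact C) (w : S → ℝ) :
    BddAbove ((fun P : S → ℝ => ∑ s', P s' * w s') '' C) :=
  (hC.image (by fun_prop)).bddAbove

lemma le_sig {C : Set (S → ℝ)} (hC : IsCompact C) (w : S → ℝ) {P : S → ℝ} (hP : P ∈ C) :
    ∑ s', P s' * w s' ≤ sig C w :=
  le_csSup (sig_bdd hC w) ⟨P, hP, rfl⟩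

lemma sig_le {C : Set (S → ℝ)} (hne : C.Nonempty) (w : S → ℝ) {b : ℝ}
    (hb : ∀ P ∈ C, ∑ s', P s' * w s' ≤ b) : sig C w ≤ b := by
  refine csSup_le (hne.image _) ?_
  rintro _ ⟨P, hP, rfl⟩
  exact hb P hP

lemma sig_continuous {C : Set (S → ℝ)} (hC : IsCompact C) : Continuous (sig C) := by
  unfold sig
  refine hC.continuous_sSup (f := fun (w P : S → ℝ) => ∑ s', P s' * w s') ?_
  show Continuous (fun x : (S → ℝ) × (S → ℝ) => ∑ s', x.2 s' * x.1 s')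
  fun_prop

/-- clean extended value iteration -/
noncomputable def eviC (𝒞 : S → A → Set (S → ℝ)) (r : S → A → ℕ → ℝ) : ℕ → ℕ → S → ℝ
  | 0, _, _ => 0
  | n + 1, h, s => ⨆ a : A, (r s a h + sig (𝒞 s a) (eviC 𝒞 r n (h + 1)))

/-- optimistic action values -/
noncomputable def qv (𝒞 : S → A → Set (S → ℝ)) (r : S → A → ℕ → ℝ) (n h : ℕ) (s : S) (a : A) : ℝ :=
  r s a h + sig (𝒞 s a) (eviC 𝒞 r n (h + 1))

lemma qv_le_eviC (𝒞 : S → A → Set (S → ℝ)) (r : S → A → ℕ → ℝ) (n h : ℕ) (s : S) (a : A) :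
    qv 𝒞 r n h s a ≤ eviC 𝒞 r (n + 1) h s :=
  le_ciSup (f := fun a => r s a h + sig (𝒞 s a) (eviC 𝒞 r n (h + 1)))
    (Set.finite_range _).bddAbove a

lemma eviC_congr (𝒞 : S → A → Set (S → ℝ)) (r r' : S → A → ℕ → ℝ) (n : ℕ) :
    ∀ (h : ℕ) (_ : ∀ k, h ≤ k → k < h + n → ∀ s a, r s a k = r' s a k),
    eviC 𝒞 r n h = eviC 𝒞 r' n h := by
  induction n with
  | zero => intro h _; rfl
  | succ n ih =>
    intro h hh
    funext s
    simp only [eviC]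
    rw [ih (h + 1) (fun k hk hk' => hh k (by omega) (by omega))]
    simp only [hh h le_rfl (by omega)]

lemma eviC_measurable {X : Type} [MeasurableSpace X] (𝒞 : S → A → Set (S → ℝ))
    (hC : ∀ s a, IsCompact (𝒞 s a))
    (r : X → S → A → ℕ → ℝ) (hr : ∀ s a k, Measurable fun x => r x s a k) (n : ℕ) :
    ∀ h, Measurable fun x => eviC 𝒞 (r x) n h := by
  induction n with
  | zero => intro h; exact measurable_const
  | succ n ih =>
    intro h
    refine measurable_pi_lambda _ fun s => ?_
    refine Measurable.iSup fun a => ?_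
    exact (hr s a h).add ((sig_continuous (hC s a)).measurable.comp (ih (h + 1)))

lemma qv_measurable {X : Type} [MeasurableSpace X] (𝒞 : S → A → Set (S → ℝ))
    (hC : ∀ s a, IsCompact (𝒞 s a))
    (r : X → S → A → ℕ → ℝ) (hr : ∀ s a k, Measurable fun x => r x s a k) (n h : ℕ) (s : S) (a : A) :
    Measurable fun x => qv 𝒞 (r x) n h s a :=
  (hr s a h).add ((sig_continuous (hC s a)).measurable.comp (eviC_measurable 𝒞 hC r hr n (h + 1)))

variable (𝒞 : S → A → Set (S → ℝ))

lemma eviC_mono [Nonempty A] (hne : ∀ s a, (𝒞 s a).Nonempty)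
    (hC : ∀ s a, IsCompact (𝒞 s a))
    (hprob : ∀ s a, ∀ Q ∈ 𝒞 s a, (∀ s', 0 ≤ Q s') ∧ ∑ s' : S, Q s' = 1)
    (r r' : S → A → ℕ → ℝ) (hr : ∀ s a k, r s a k ≤ r' s a k) (n : ℕ) :
    ∀ h s, eviC 𝒞 r n h s ≤ eviC 𝒞 r' n h s := by
  induction n with
  | zero => intro h s; exact le_rfl
  | succ n ih =>
    intro h s
    refine ciSup_le fun a => ?_
    refine le_trans ?_ (qv_le_eviC 𝒞 r' n h s a)
    refine add_le_add (hr _ _ _) (sig_le (hne s a) _ fun P hP => ?_)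
    refine le_trans (Finset.sum_le_sum fun s' _ => ?_) (le_sig (hC s a) _ hP)
    exact mul_le_mul_of_nonneg_left (ih _ _) ((hprob s a P hP).1 s')

lemma qv_mono [Nonempty A] (hne : ∀ s a, (𝒞 s a).Nonempty)
    (hC : ∀ s a, IsCompact (𝒞 s a))
    (hprob : ∀ s a, ∀ Q ∈ 𝒞 s a, (∀ s', 0 ≤ Q s') ∧ ∑ s' : S, Q s' = 1)
    (r r' : S → A → ℕ → ℝ) (hr : ∀ s a k, r s a k ≤ r' s a k) (n h : ℕ) (s : S) (a : A) :
    qv 𝒞 r n h s a ≤ qv 𝒞 r' n h s a := by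
  refine add_le_add (hr _ _ _) (sig_le (hne s a) _ fun P hP => ?_)
  refine le_trans (Finset.sum_le_sum fun s' _ => ?_) (le_sig (hC s a) _ hP)
  exact mul_le_mul_of_nonneg_left (eviC_mono 𝒞 hne hC hprob r r' hr _ _ _) ((hprob s a P hP).1 s')

lemma qv_step (hne : ∀ s a, (𝒞 s a).Nonempty)
    (hC : ∀ s a, IsCompact (𝒞 s a))
    (hprob : ∀ s a, ∀ Q ∈ 𝒞 s a, (∀ s', 0 ≤ Q s') ∧ ∑ s' : S, Q s' = 1)
    (r r' : S → A → ℕ → ℝ) (hr : ∀ s a k, r' s a k ≤ r s a k + 1) (n h : ℕ)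
    (ih : ∀ s, eviC 𝒞 r' n (h + 1) s ≤ eviC 𝒞 r n (h + 1) s + n) (s : S) (a : A) :
    qv 𝒞 r' n h s a ≤ qv 𝒞 r n h s a + (n + 1 : ℕ) := by
  have : sig (𝒞 s a) (eviC 𝒞 r' n (h + 1)) ≤ sig (𝒞 s a) (eviC 𝒞 r n (h + 1)) + n := by
    refine sig_le (hne s a) _ fun P hP => ?_
    have h1 : ∑ s', P s' * eviC 𝒞 r' n (h + 1) s'
        ≤ ∑ s', (P s' * eviC 𝒞 r n (h + 1) s' + P s' * n) := by
      refine Finset.sum_le_sum fun s' _ => ?_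
      rw [← mul_add]
      exact mul_le_mul_of_nonneg_left (ih s') ((hprob s a P hP).1 s')
    rw [Finset.sum_add_distrib, ← Finset.sum_mul, (hprob s a P hP).2, one_mul] at h1
    have := le_sig (hC s a) (eviC 𝒞 r n (h + 1)) hP
    linarith
  have := hr s a h
  unfold qv
  push_cast
  linarith

lemma eviC_lip [Nonempty A] (hne : ∀ s a, (𝒞 s a).Nonempty)
    (hC : ∀ s a, IsCompact (𝒞 s a))
    (hprob : ∀ s a, ∀ Q ∈ 𝒞 s a, (∀ s', 0 ≤ Q s') ∧ ∑ s' : S, Q s' = 1)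
    (r r' : S → A → ℕ → ℝ) (hr : ∀ s a k, r' s a k ≤ r s a k + 1) (n : ℕ) :
    ∀ h s, eviC 𝒞 r' n h s ≤ eviC 𝒞 r n h s + n := by
  induction n with
  | zero => intro h s; simp [eviC]
  | succ n ih =>
    intro h s
    refine ciSup_le fun a => ?_
    have := qv_step 𝒞 hne hC hprob r r' hr n h (ih (h + 1)) s a
    have h2 := qv_le_eviC 𝒞 r n h s a
    unfold qv at this h2
    linarith

lemma eviC_convex [Nonempty A] (hne : ∀ s a, (𝒞 s a).Nonempty)
    (hC : ∀ s a, IsCompact (𝒞 s a))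
    (hprob : ∀ s a, ∀ Q ∈ 𝒞 s a, (∀ s', 0 ≤ Q s') ∧ ∑ s' : S, Q s' = 1)
    (r r' q : S → A → ℕ → ℝ) (α β : ℝ) (hα : 0 ≤ α) (hβ : 0 ≤ β)
    (hq : ∀ s a k, q s a k = α * r s a k + β * r' s a k) (n : ℕ) :
    ∀ h s, eviC 𝒞 q n h s ≤ α * eviC 𝒞 r n h s + β * eviC 𝒞 r' n h s := by
  induction n with
  | zero => intro h s; simp [eviC]
  | succ n ih =>
    intro h s
    refine ciSup_le fun a => ?_
    have h1 := mul_le_mul_of_nonneg_left (qv_le_eviC 𝒞 r n h s a) hα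
    have h2 := mul_le_mul_of_nonneg_left (qv_le_eviC 𝒞 r' n h s a) hβ
    have h3 : sig (𝒞 s a) (eviC 𝒞 q n (h + 1)) ≤ α * sig (𝒞 s a) (eviC 𝒞 r n (h + 1))
        + β * sig (𝒞 s a) (eviC 𝒞 r' n (h + 1)) := by
      refine sig_le (hne s a) _ fun P hP => ?_
      have e1 : ∑ s', P s' * eviC 𝒞 q n (h + 1) s'
          ≤ ∑ s', (α * (P s' * eviC 𝒞 r n (h + 1) s') + β * (P s' * eviC 𝒞 r' n (h + 1) s')) := by
        refine Finset.sum_le_sum fun s' _ => ?_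
        have := mul_le_mul_of_nonneg_left (ih (h + 1) s') ((hprob s a P hP).1 s')
        linarith
      rw [Finset.sum_add_distrib, ← Finset.mul_sum, ← Finset.mul_sum] at e1
      have e2 := mul_le_mul_of_nonneg_left (le_sig (hC s a) (eviC 𝒞 r n (h + 1)) hP) hα
      have e3 := mul_le_mul_of_nonneg_left (le_sig (hC s a) (eviC 𝒞 r' n (h + 1)) hP) hβ
      linarith
    unfold qv at h1 h2
    rw [hq]
    linarith

lemma pv_le_eviC (hC : ∀ s a, IsCompact (𝒞 s a))
    (hprob : ∀ s a, ∀ Q ∈ 𝒞 s a, (∀ s', 0 ≤ Q s') ∧ ∑ s' : S, Q s' = 1)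
    (p : ℕ → S → A → S → ℝ) (hp : ∀ h s a, (fun s' => p h s a s') ∈ 𝒞 s a)
    (r : S → A → ℕ → ℝ) (π : S → ℕ → A) (n : ℕ) :
    ∀ h s, polValL p r π n h s ≤ eviC 𝒞 r n h s := by
  induction n with
  | zero => intro h s; exact le_rfl
  | succ n ih =>
    intro h s
    refine le_trans ?_ (qv_le_eviC 𝒞 r n h s (π s h))
    simp only [polValL, qv]
    refine add_le_add le_rfl ?_
    refine le_trans (Finset.sum_le_sum fun s' _ => ?_) (le_sig (hC s (π s h)) _ (hp h s (π s h)))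
    exact mul_le_mul_of_nonneg_left (ih _ _) ((hprob s _ _ (hp h s (π s h))).1 s')

lemma evi_eq_eviC [Nonempty A] (hne : ∀ s a, (𝒞 s a).Nonempty)
    (hC : ∀ s a, IsCompact (𝒞 s a))
    (hprob : ∀ s a, ∀ Q ∈ 𝒞 s a, (∀ s', 0 ≤ Q s') ∧ ∑ s' : S, Q s' = 1)
    (r : S → A → ℕ → ℝ) (n : ℕ) :
    ∀ h, (∀ k, h ≤ k → k < h + n → ∀ s a, 0 ≤ r s a k) →
      evi 𝒞 r n h = eviC 𝒞 r n h ∧ ∀ s, 0 ≤ eviC 𝒞 r n h s := by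
  induction n with
  | zero => intro h _; exact ⟨rfl, fun s => le_rfl⟩
  | succ n ih =>
    intro h hr
    obtain ⟨h1, h2⟩ := ih (h + 1) (fun k hk hk' => hr k (by omega) (by omega))
    have hq : ∀ s a, 0 ≤ qv 𝒞 r n h s a := by
      intro s a
      refine add_nonneg (hr h le_rfl (by omega) s a) ?_
      obtain ⟨P, hP⟩ := hne s a
      refine le_trans (Finset.sum_nonneg fun s' _ => ?_) (le_sig (hC s a) _ hP)
      exact mul_nonneg ((hprob s a P hP).1 s') (h2 s')
    refine ⟨?_, fun s => ?_⟩
    · funext s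
      simp only [evi, eviC, h1]
      congr 1
      funext a
      have hub : ∀ P : S → ℝ, (⨆ (_ : P ∈ 𝒞 s a), (r s a h + ∑ s' : S, P s' * eviC 𝒞 r n (h + 1) s'))
          ≤ r s a h + sig (𝒞 s a) (eviC 𝒞 r n (h + 1)) := by
        intro P
        by_cases hP : P ∈ 𝒞 s a
        · rw [ciSup_pos hP]
          exact add_le_add le_rfl (le_sig (hC s a) _ hP)
        · have : IsEmpty (P ∈ 𝒞 s a) := ⟨hP⟩
          rw [Real.iSup_of_isEmpty]
          exact hq s a
      refine le_antisymm (ciSup_le hub) ?_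
      rw [← le_sub_iff_add_le']
      refine sig_le (hne s a) _ fun P hP => ?_
      rw [le_sub_iff_add_le']
      refine le_trans ?_ (le_ciSup (f := fun P : S → ℝ => ⨆ (_ : P ∈ 𝒞 s a),
        (r s a h + ∑ s' : S, P s' * eviC 𝒞 r n (h + 1) s')) ?_ P)
      · simp only [ciSup_pos hP]; exact le_rfl
      · refine ⟨r s a h + sig (𝒞 s a) (eviC 𝒞 r n (h + 1)), ?_⟩
        rintro _ ⟨P, rfl⟩
        exact hub P
    · obtain ⟨a⟩ := (inferInstance : Nonempty A)
      exact le_trans (hq s a) (qv_le_eviC 𝒞 r n h s a)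

/-- A consistent policy is greedy for the optimistic action values. -/
lemma greedy [Nonempty A] (hne : ∀ s a, (𝒞 s a).Nonempty)
    (hC : ∀ s a, IsCompact (𝒞 s a))
    (hprob : ∀ s a, ∀ Q ∈ 𝒞 s a, (∀ s', 0 ≤ Q s') ∧ ∑ s' : S, Q s' = 1)
    (r : S → A → ℕ → ℝ) (H : ℕ) (hr : ∀ k, 1 ≤ k → k ≤ H → ∀ s a, 0 ≤ r s a k)
    (π : S → ℕ → A) (p : ℕ → S → A → S → ℝ) (hcons : EVIConsistent 𝒞 r H π p)
    (h : ℕ) (h1 : 1 ≤ h) (hH : h ≤ H) (s : S) (a : A) :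
    qv 𝒞 r (H - h) h s a ≤ qv 𝒞 r (H - h) h s (π s h) := by
  have e : H + 1 - h = (H - h) + 1 := by omega
  have k1 := hcons.2 h s h1 hH
  rw [e, (evi_eq_eviC 𝒞 hne hC hprob r (H - h + 1) h
    (fun k hk hk' => hr k (by omega) (by omega))).1] at k1
  refine (qv_le_eviC 𝒞 r (H - h) h s a).trans ?_
  rw [← k1]
  simp only [polValL, qv]
  refine add_le_add le_rfl ?_
  refine le_trans (Finset.sum_le_sum fun s' _ => ?_) (le_sig (hC s (π s h)) _ (hcons.1 h s (π s h)))
  exact mul_le_mul_of_nonneg_left (pv_le_eviC 𝒞 hC hprob p hcons.1 r π _ _ _)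
    ((hprob s _ _ (hcons.1 h s (π s h))).1 s')

end FPOPAux

section FPOPMeasure

open scoped ENNReal

lemma exp_shift (η : ℝ) (c : ℝ) (hc : 0 ≤ c) (f : ℝ → ℝ≥0∞) (hf : Measurable f) :
    ∫⁻ y, f (y + c) ∂(expMeasure η) ≤ ENNReal.ofReal (Real.exp (η * c)) * ∫⁻ y, f y ∂(expMeasure η) := by
  have hm : Measurable (exponentialPDF η) := (measurable_exponentialPDFReal η).ennreal_ofReal
  have he : expMeasure η = volume.withDensity (exponentialPDF η) := rfl
  rw [he, lintegral_withDensity_eq_lintegral_mul _ hm (by fun_prop),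
    lintegral_withDensity_eq_lintegral_mul _ hm hf, ← lintegral_const_mul _ (hm.mul hf)]
  rw [← lintegral_sub_right_eq_self _ c]
  refine lintegral_mono fun y => ?_
  simp only [Pi.mul_apply, sub_add_cancel]
  rw [← mul_assoc]
  refine mul_le_mul' ?_ le_rfl
  by_cases hy : y - c < 0
  · rw [exponentialPDF_of_neg hy]; exact zero_le
  · push Not at hy
    rw [exponentialPDF_of_nonneg hy, exponentialPDF_of_nonneg (by linarith),
      ← ENNReal.ofReal_mul (Real.exp_pos _).le]
    refine ENNReal.ofReal_le_ofReal (le_of_eq ?_)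
    rw [mul_left_comm, ← Real.exp_add]
    congr 2; ring

lemma exp_nonneg_ae (η : ℝ) : ∀ᵐ y ∂(expMeasure η), 0 ≤ y := by
  have hm : Measurable (exponentialPDF η) := (measurable_exponentialPDFReal η).ennreal_ofReal
  have he : expMeasure η = volume.withDensity (exponentialPDF η) := rfl
  rw [he, ae_withDensity_iff hm]
  refine Filter.Eventually.of_forall fun y hy => ?_
  by_contra hlt
  exact hy (exponentialPDF_of_neg (not_le.mp hlt))

variable {ι : Type} [Fintype ι] [DecidableEq ι]

lemma pi_shift (η : ℝ) (hη : 0 < η) (c : ℝ) (hc : 0 ≤ c) (x : ι) (f : (ι → ℝ) → ℝ≥0∞)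
    (hf : Measurable f) :
    ∫⁻ R, f (R + Pi.single x c) ∂(Measure.pi fun _ : ι => expMeasure η)
      ≤ ENNReal.ofReal (Real.exp (η * c)) * ∫⁻ R, f R ∂(Measure.pi fun _ : ι => expMeasure η) := by
  have := isProbabilityMeasure_expMeasure hη
  rw [← lintegral_const_mul _ hf]
  refine lintegral_le_of_lmarginal_le {x} (by fun_prop) (by fun_prop) ?_
  rw [lmarginal_singleton, lmarginal_singleton]
  intro R
  have key := exp_shift η c hc (fun y => f (Function.update R x y)) (by fun_prop)
  simp only
  rw [lintegral_const_mul _ (by fun_prop)]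
  refine le_trans (le_of_eq ?_) key
  refine lintegral_congr fun y => ?_
  congr 1
  funext i
  by_cases hi : i = x
  · subst hi; simp
  · simp [hi]

lemma window (η : ℝ) (hη : 0 < η) (L : ℝ) (hL : 0 ≤ L) (x : ι) (G : (ι → ℝ) → ℝ≥0∞)
    (hG : Measurable G) (N : Set (ι → ℝ)) (hN : MeasurableSet N)
    (hGN : ∀ R, G R ≤ N.indicator G (R + Pi.single x L))
    (hfin : ∫⁻ R, G R ∂(Measure.pi fun _ : ι => expMeasure η) ≠ ∞) :
    ∫⁻ R, Nᶜ.indicator G R ∂(Measure.pi fun _ : ι => expMeasure η)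
      ≤ ENNReal.ofReal (η * L) * ∫⁻ R, G R ∂(Measure.pi fun _ : ι => expMeasure η) := by
  have h1 := (lintegral_mono hGN).trans (pi_shift η hη L hL x (N.indicator G) (hG.indicator hN))
  have h2 := lintegral_add_compl (μ := Measure.pi fun _ : ι => expMeasure η) G hN
  rw [← lintegral_indicator hN, ← lintegral_indicator hN.compl] at h2
  set K := ∫⁻ R, G R ∂(Measure.pi fun _ : ι => expMeasure η)
  set a := ∫⁻ R, N.indicator G R ∂(Measure.pi fun _ : ι => expMeasure η)
  set b := ∫⁻ R, Nᶜ.indicator G R ∂(Measure.pi fun _ : ι => expMeasure η)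
  have ha : a ≠ ∞ := ne_top_of_le_ne_top hfin (h2 ▸ le_self_add)
  have hb : b ≠ ∞ := ne_top_of_le_ne_top hfin (h2 ▸ le_add_self)
  have h1' : K.toReal ≤ Real.exp (η * L) * a.toReal := by
    have := ENNReal.toReal_mono (ENNReal.mul_ne_top ENNReal.ofReal_ne_top ha) h1
    rwa [ENNReal.toReal_mul, ENNReal.toReal_ofReal (Real.exp_pos _).le] at this
  have h2' : a.toReal + b.toReal = K.toReal := by
    rw [← h2, ENNReal.toReal_add ha hb]
  have h3 : b.toReal ≤ η * L * K.toReal := by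
    have e1 : Real.exp (-(η * L)) * K.toReal ≤ a.toReal := by
      rw [Real.exp_neg, inv_mul_le_iff₀ (Real.exp_pos _)]; exact h1'
    have e2 : 1 - η * L ≤ Real.exp (-(η * L)) := by
      have := Real.add_one_le_exp (-(η * L)); linarith
    have e3 := mul_le_mul_of_nonneg_right e2 (ENNReal.toReal_nonneg (a := K))
    nlinarith
  rw [← ENNReal.ofReal_toReal hb, ← ENNReal.ofReal_toReal hfin,
    ← ENNReal.ofReal_mul (by positivity)]
  exact ENNReal.ofReal_le_ofReal h3

end FPOPMeasure

section FPOPCombine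

open scoped ENNReal

variable {S A : Type} [Fintype S] [Fintype A] [DecidableEq S] [DecidableEq A] {H : ℕ}

/-- extend a perturbation vector to a reward function -/
noncomputable def extR (R : S × A × Fin H → ℝ) (s : S) (a : A) (k : ℕ) : ℝ :=
  if h : k - 1 < H then R (s, a, ⟨k - 1, h⟩) else 0

/-- the perturbed cumulative reward -/
noncomputable def rew (c : S → A → ℕ → ℝ) (R : S × A × Fin H → ℝ) (s : S) (a : A) (k : ℕ) : ℝ :=
  extR R s a k + c s a k

/-- indicator reward -/
noncomputable def ind (x : S × A × Fin H) (s : S) (a : A) (k : ℕ) : ℝ :=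
  if x.1 = s ∧ x.2.1 = a ∧ x.2.2.val + 1 = k then 1 else 0

lemma extR_add (R R' : S × A × Fin H → ℝ) (s : S) (a : A) (k : ℕ) :
    extR (R + R') s a k = extR R s a k + extR R' s a k := by
  unfold extR
  split_ifs <;> simp

lemma extR_single (x : S × A × Fin H) (c : ℝ) (s : S) (a : A) (k : ℕ) :
    extR (Pi.single x c) s a k = c * extR (Pi.single x 1) s a k := by
  unfold extR
  split_ifs
  · simp only [Pi.single_apply]
    split_ifs <;> simp
  · simp

lemma extR_single_one (x : S × A × Fin H) (s : S) (a : A) (k : ℕ) (hk : 1 ≤ k) :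
    extR (Pi.single x 1) s a k = ind x s a k := by
  obtain ⟨s', a', h'⟩ := x
  unfold extR ind
  split_ifs with h1 h2 h2
  · obtain ⟨rfl, rfl, h3⟩ := h2
    have : (⟨k - 1, h1⟩ : Fin H) = h' := by ext; simp at h3 ⊢; omega
    rw [this]; simp
  · rw [Pi.single_apply, if_neg]
    rintro h3
    simp only [Prod.mk.injEq] at h3
    obtain ⟨rfl, rfl, rfl⟩ := h3
    apply h2
    simp; omega
  · obtain ⟨rfl, rfl, h3⟩ := h2
    have := h'.2
    simp at h3
    omega
  · rfl

lemma rew_single (c : S → A → ℕ → ℝ) (R : S × A × Fin H → ℝ) (x : S × A × Fin H) (L : ℝ)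
    (s : S) (a : A) (k : ℕ) (hk : 1 ≤ k) :
    rew c (R + Pi.single x L) s a k = rew c R s a k + L * ind x s a k := by
  unfold rew
  rw [extR_add, extR_single, extR_single_one x s a k hk]
  ring

variable (𝒞 : S → A → Set (S → ℝ))

/-- optimal optimistic value as a function of the perturbation -/
noncomputable def FF (c : S → A → ℕ → ℝ) (s0 : S) (R : S × A × Fin H → ℝ) : ℝ :=
  eviC 𝒞 (rew c R) H 1 s0

/-- forward difference quotient -/
noncomputable def dq (c : S → A → ℕ → ℝ) (s0 : S) (ε : ℝ) (x : S × A × Fin H)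
    (R : S × A × Fin H → ℝ) : ℝ :=
  (FF 𝒞 c s0 (R + Pi.single x ε) - FF 𝒞 c s0 R) / ε

/-- backward difference quotient -/
noncomputable def bq (c : S → A → ℕ → ℝ) (s0 : S) (ε : ℝ) (x : S × A × Fin H)
    (R : S × A × Fin H → ℝ) : ℝ :=
  (FF 𝒞 c s0 R - FF 𝒞 c s0 (R + Pi.single x (-ε))) / ε

lemma dq_eq_bq (c : S → A → ℕ → ℝ) (s0 : S) (ε : ℝ) (x : S × A × Fin H)
    (R : S × A × Fin H → ℝ) : dq 𝒞 c s0 ε x R = bq 𝒞 c s0 ε x (R + Pi.single x ε) := by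
  unfold dq bq
  rw [add_assoc, ← Pi.single_add]
  simp

lemma rew_measurable (c : S → A → ℕ → ℝ) (s : S) (a : A) (k : ℕ) :
    Measurable fun R : S × A × Fin H → ℝ => rew c R s a k := by
  unfold rew extR
  split_ifs <;> fun_prop

lemma FF_measurable (hC : ∀ s a, IsCompact (𝒞 s a)) (c : S → A → ℕ → ℝ) (s0 : S) :
    Measurable fun R : S × A × Fin H → ℝ => FF 𝒞 c s0 R :=
  (measurable_pi_apply s0).comp (eviC_measurable 𝒞 hC _ (rew_measurable c) H 1)

lemma dq_measurable (hC : ∀ s a, IsCompact (𝒞 s a)) (c : S → A → ℕ → ℝ) (s0 : S) (ε : ℝ)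
    (x : S × A × Fin H) : Measurable (dq 𝒞 c s0 ε x) :=
  (((FF_measurable 𝒞 hC c s0).comp (measurable_id.add_const _)).sub
    (FF_measurable 𝒞 hC c s0)).div_const _

lemma bq_measurable (hC : ∀ s a, IsCompact (𝒞 s a)) (c : S → A → ℕ → ℝ) (s0 : S) (ε : ℝ)
    (x : S × A × Fin H) : Measurable (bq 𝒞 c s0 ε x) :=
  ((FF_measurable 𝒞 hC c s0).sub
    ((FF_measurable 𝒞 hC c s0).comp (measurable_id.add_const _))).div_const _

lemma dq_mono [Nonempty A] (hne : ∀ s a, (𝒞 s a).Nonempty)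
    (hC : ∀ s a, IsCompact (𝒞 s a))
    (hprob : ∀ s a, ∀ Q ∈ 𝒞 s a, (∀ s', 0 ≤ Q s') ∧ ∑ s' : S, Q s' = 1)
    (c : S → A → ℕ → ℝ) (s0 : S) (ε L : ℝ) (hε : 0 < ε) (hL : 0 ≤ L) (x : S × A × Fin H)
    (R : S × A × Fin H → ℝ) :
    dq 𝒞 c s0 ε x R ≤ dq 𝒞 c s0 ε x (R + Pi.single x L) := by
  have hpos : 0 < L + ε := by linarith
  have h1 := eviC_convex 𝒞 hne hC hprob (rew c R) (rew c (R + Pi.single x L + Pi.single x ε))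
    (rew c (R + Pi.single x ε)) (L / (L + ε)) (ε / (L + ε)) (by positivity) (by positivity)
    (by
      intro s a k
      simp only [rew, extR_add, extR_single x L, extR_single x ε]
      field_simp
      ring) H 1 s0
  have h2 := eviC_convex 𝒞 hne hC hprob (rew c R) (rew c (R + Pi.single x L + Pi.single x ε))
    (rew c (R + Pi.single x L)) (ε / (L + ε)) (L / (L + ε)) (by positivity) (by positivity)
    (by
      intro s a k
      simp only [rew, extR_add, extR_single x L, extR_single x ε]
      field_simp
      ring) H 1 s0
  have h3 : L / (L + ε) + ε / (L + ε) = 1 := by field_simp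
  unfold dq FF
  refine div_le_div_of_nonneg_right ?_ hε.le
  have h4 : L / (L + ε) = 1 - ε / (L + ε) := by linarith
  rw [h4] at h1 h2
  nlinarith

lemma occ_le (hC : ∀ s a, IsCompact (𝒞 s a))
    (hprob : ∀ s a, ∀ Q ∈ 𝒞 s a, (∀ s', 0 ≤ Q s') ∧ ∑ s' : S, Q s' = 1)
    (p : ℕ → S → A → S → ℝ) (hp : ∀ h s a, (fun s' => p h s a s') ∈ 𝒞 s a)
    (π : S → ℕ → A) (c : S → A → ℕ → ℝ) (s0 : S) (R : S × A × Fin H → ℝ)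
    (hopt : polValL p (rew c R) π H 1 s0 = FF 𝒞 c s0 R) (x : S × A × Fin H) (L : ℝ) :
    FF 𝒞 c s0 R + L * polValL p (ind x) π H 1 s0 ≤ FF 𝒞 c s0 (R + Pi.single x L) := by
  refine le_trans (le_of_eq ?_) (pv_le_eviC 𝒞 hC hprob p hp (rew c (R + Pi.single x L)) π H 1 s0)
  rw [← hopt, ← pv_smul, ← pv_add]
  refine pv_congr p _ _ π H 1 (fun k hk _ s => ?_) s0
  rw [rew_single c R x L s _ k hk]

lemma occ_le_dq (hC : ∀ s a, IsCompact (𝒞 s a))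
    (hprob : ∀ s a, ∀ Q ∈ 𝒞 s a, (∀ s', 0 ≤ Q s') ∧ ∑ s' : S, Q s' = 1)
    (p : ℕ → S → A → S → ℝ) (hp : ∀ h s a, (fun s' => p h s a s') ∈ 𝒞 s a)
    (π : S → ℕ → A) (c : S → A → ℕ → ℝ) (s0 : S) (R : S × A × Fin H → ℝ)
    (hopt : polValL p (rew c R) π H 1 s0 = FF 𝒞 c s0 R) (x : S × A × Fin H) (ε : ℝ) (hε : 0 < ε) :
    polValL p (ind x) π H 1 s0 ≤ dq 𝒞 c s0 ε x R := by
  have := occ_le 𝒞 hC hprob p hp π c s0 R hopt x ε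
  unfold dq
  rw [le_div_iff₀ hε]
  linarith

lemma bq_le_occ (hC : ∀ s a, IsCompact (𝒞 s a))
    (hprob : ∀ s a, ∀ Q ∈ 𝒞 s a, (∀ s', 0 ≤ Q s') ∧ ∑ s' : S, Q s' = 1)
    (p : ℕ → S → A → S → ℝ) (hp : ∀ h s a, (fun s' => p h s a s') ∈ 𝒞 s a)
    (π : S → ℕ → A) (c : S → A → ℕ → ℝ) (s0 : S) (R : S × A × Fin H → ℝ)
    (hopt : polValL p (rew c R) π H 1 s0 = FF 𝒞 c s0 R) (x : S × A × Fin H) (ε : ℝ) (hε : 0 < ε) :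
    bq 𝒞 c s0 ε x R ≤ polValL p (ind x) π H 1 s0 := by
  have := occ_le 𝒞 hC hprob p hp π c s0 R hopt x (-ε)
  unfold bq
  rw [div_le_iff₀ hε]
  linarith

lemma sum_ind (f : S × A × Fin H → ℝ) (s : S) (a : A) (k : ℕ)
    (hk : 1 ≤ k) (hk' : k - 1 < H) :
    ∑ x, f x * ind x s a k = f (s, a, ⟨k - 1, hk'⟩) := by
  rw [Finset.sum_eq_single (s, a, (⟨k - 1, hk'⟩ : Fin H))]
  · unfold ind
    rw [if_pos]
    · simp
    · refine ⟨rfl, rfl, ?_⟩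
      simp; omega
  · rintro ⟨s', a', h'⟩ _ hx
    unfold ind
    rw [if_neg]
    · simp
    · rintro ⟨rfl, rfl, h3⟩
      apply hx
      congr 2
      ext
      simp at h3 ⊢
      omega
  · intro h; exact absurd (Finset.mem_univ _) h

lemma sum_occ (p : ℕ → S → A → S → ℝ) (hp1 : ∀ h s a, ∑ s', p h s a s' = 1)
    (π : S → ℕ → A) (s0 : S) :
    ∑ x : S × A × Fin H, polValL p (ind x) π H 1 s0 = H := by
  rw [← pv_sum, ← pv_one p hp1 π H 1 s0]
  refine pv_congr p _ _ π H 1 (fun k hk hk' s => ?_) s0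
  have := sum_ind (H := H) (fun _ => 1) s (π s k) k hk (by omega)
  simpa using this

lemma diff_occ (p : ℕ → S → A → S → ℝ) (hp : ∀ h s a s', 0 ≤ p h s a s')
    (hp1 : ∀ h s a, ∑ s', p h s a s' = 1)
    (r : S → A → ℕ → ℝ) (hr : ∀ s a k, 0 ≤ r s a k ∧ r s a k ≤ 1) (π π' : S → ℕ → A) (s0 : S) :
    polValL p r π' H 1 s0 - polValL p r π H 1 s0
      ≤ H * ∑ x : S × A × Fin H, (if π' x.1 (x.2.2.val + 1) = x.2.1 ∧ π x.1 (x.2.2.val + 1) ≠ x.2.1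
          then polValL p (ind x) π' H 1 s0 else 0) := by
  refine (pv_diff p hp hp1 r hr π π' H H 1 s0 le_rfl).trans (le_of_eq ?_)
  rw [Finset.mul_sum]
  have e : ∀ x : S × A × Fin H, (H : ℝ) * (if π' x.1 (x.2.2.val + 1) = x.2.1 ∧
      π x.1 (x.2.2.val + 1) ≠ x.2.1 then polValL p (ind x) π' H 1 s0 else 0)
      = polValL p (fun s a k => (if π' x.1 (x.2.2.val + 1) = x.2.1 ∧
      π x.1 (x.2.2.val + 1) ≠ x.2.1 then (H : ℝ) else 0) * ind x s a k) π' H 1 s0 := by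
    intro x
    rw [pv_smul]
    split_ifs <;> simp
  rw [Finset.sum_congr rfl fun x _ => e x, ← pv_sum]
  refine pv_congr p _ _ π' H 1 (fun k hk hk' s => ?_) s0
  have := sum_ind (H := H) (fun x => if π' x.1 (x.2.2.val + 1) = x.2.1 ∧
      π x.1 (x.2.2.val + 1) ≠ x.2.1 then (H : ℝ) else 0) s (π' s k) k hk (by omega)
  rw [this]
  have hk1 : k - 1 + 1 = k := by omega
  simp only [hk1]

lemma qv_shift (c : S → A → ℕ → ℝ) (R : S × A × Fin H → ℝ) (x : S × A × Fin H) (L : ℝ) (n : ℕ)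
    (a' : A) :
    qv 𝒞 (rew c (R + Pi.single x L)) n (x.2.2.val + 1) x.1 a'
      = qv 𝒞 (rew c R) n (x.2.2.val + 1) x.1 a' + if x.2.1 = a' then L else 0 := by
  unfold qv
  rw [rew_single c R x L _ _ _ (by omega)]
  have hcongr : eviC 𝒞 (rew c (R + Pi.single x L)) n (x.2.2.val + 1 + 1)
      = eviC 𝒞 (rew c R) n (x.2.2.val + 1 + 1) := by
    apply eviC_congr
    intro k hk _ s a
    rw [rew_single c R x L _ _ _ (by omega)]
    unfold ind
    rw [if_neg]
    · ring
    · rintro ⟨_, _, h⟩; omega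
  rw [hcongr]
  unfold ind
  simp only [true_and, and_true]
  split_ifs <;> ring

/-- the perturbations for which action `x.2.1` is optimal for reward offset `c` -/
def MM (c : S → A → ℕ → ℝ) (x : S × A × Fin H) : Set (S × A × Fin H → ℝ) :=
  {R | ∀ a', qv 𝒞 (rew c R) (H - (x.2.2.val + 1)) (x.2.2.val + 1) x.1 a'
    ≤ qv 𝒞 (rew c R) (H - (x.2.2.val + 1)) (x.2.2.val + 1) x.1 x.2.1}

/-- the perturbations for which action `x.2.1` is strictly optimal for reward offset `c` -/
def NN (c : S → A → ℕ → ℝ) (x : S × A × Fin H) : Set (S × A × Fin H → ℝ) :=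
  {R | ∀ a', a' ≠ x.2.1 → qv 𝒞 (rew c R) (H - (x.2.2.val + 1)) (x.2.2.val + 1) x.1 a'
    < qv 𝒞 (rew c R) (H - (x.2.2.val + 1)) (x.2.2.val + 1) x.1 x.2.1}

lemma MM_meas (hC : ∀ s a, IsCompact (𝒞 s a)) (c : S → A → ℕ → ℝ) (x : S × A × Fin H) :
    MeasurableSet (MM 𝒞 c x) := by
  unfold MM
  simp only [Set.ofPred_forall]
  exact MeasurableSet.iInter fun a' => measurableSet_le
    (qv_measurable 𝒞 hC _ (rew_measurable c) _ _ _ _) (qv_measurable 𝒞 hC _ (rew_measurable c) _ _ _ _)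

lemma NN_meas (hC : ∀ s a, IsCompact (𝒞 s a)) (c : S → A → ℕ → ℝ) (x : S × A × Fin H) :
    MeasurableSet (NN 𝒞 c x) := by
  unfold NN
  simp only [Set.ofPred_forall]
  exact MeasurableSet.iInter fun a' => MeasurableSet.iInter fun _ => measurableSet_lt
    (qv_measurable 𝒞 hC _ (rew_measurable c) _ _ _ _) (qv_measurable 𝒞 hC _ (rew_measurable c) _ _ _ _)

/-- the dominating function -/
noncomputable def GG (c : S → A → ℕ → ℝ) (s0 : S) (ε : ℝ) (x : S × A × Fin H) :
    (S × A × Fin H → ℝ) → ℝ≥0∞ :=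
  (MM 𝒞 c x).indicator (fun R => ENNReal.ofReal (dq 𝒞 c s0 ε x R))

lemma GG_shift [Nonempty A] (hne : ∀ s a, (𝒞 s a).Nonempty)
    (hC : ∀ s a, IsCompact (𝒞 s a))
    (hprob : ∀ s a, ∀ Q ∈ 𝒞 s a, (∀ s', 0 ≤ Q s') ∧ ∑ s' : S, Q s' = 1)
    (c1 c2 : S → A → ℕ → ℝ) (hc : ∀ s a k, c1 s a k ≤ c2 s a k ∧ c2 s a k ≤ c1 s a k + 1)
    (s0 : S) (ε L : ℝ) (hε : 0 < ε) (hL : (H : ℝ) < L) (x : S × A × Fin H)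
    (R : S × A × Fin H → ℝ) :
    GG 𝒞 c2 s0 ε x R ≤ (NN 𝒞 c1 x).indicator (GG 𝒞 c2 s0 ε x) (R + Pi.single x L) := by
  have hL0 : 0 ≤ L := (Nat.cast_nonneg H).trans hL.le
  by_cases hR : R ∈ MM 𝒞 c2 x
  · have hM : R + Pi.single x L ∈ MM 𝒞 c2 x := by
      intro a'
      rw [qv_shift, qv_shift, if_pos rfl]
      have := hR a'
      split_ifs <;> linarith
    have hN : R + Pi.single x L ∈ NN 𝒞 c1 x := by
      intro a' ha'
      rw [qv_shift, qv_shift, if_pos rfl, if_neg (Ne.symm ha')]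
      have h1 := hR a'
      have h2 := qv_mono 𝒞 hne hC hprob (rew c1 R) (rew c2 R)
        (fun s a k => by unfold rew; linarith [(hc s a k).1]) (H - (x.2.2.val + 1))
        (x.2.2.val + 1) x.1 a'
      have hr : ∀ s a k, rew c2 R s a k ≤ rew c1 R s a k + 1 :=
        fun s a k => by unfold rew; linarith [(hc s a k).2]
      have h3 := qv_step 𝒞 hne hC hprob (rew c1 R) (rew c2 R) hr (H - (x.2.2.val + 1))
        (x.2.2.val + 1) (eviC_lip 𝒞 hne hC hprob _ _ hr _ _) x.1 x.2.1
      have h4 : ((H - (x.2.2.val + 1) + 1 : ℕ) : ℝ) ≤ H := by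
        have := x.2.2.2
        exact_mod_cast (by omega : H - (x.2.2.val + 1) + 1 ≤ H)
      linarith
    rw [Set.indicator_of_mem hN]
    unfold GG
    rw [Set.indicator_of_mem hM, Set.indicator_of_mem hR]
    exact ENNReal.ofReal_le_ofReal (dq_mono 𝒞 hne hC hprob c2 s0 ε L hε hL0 x R)
  · unfold GG
    rw [Set.indicator_of_notMem hR]
    exact zero_le

/-- The integrated bound for a single entry. -/
lemma entry_bound [Nonempty A] (hne : ∀ s a, (𝒞 s a).Nonempty)
    (hC : ∀ s a, IsCompact (𝒞 s a))
    (hprob : ∀ s a, ∀ Q ∈ 𝒞 s a, (∀ s', 0 ≤ Q s') ∧ ∑ s' : S, Q s' = 1)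
    (c1 c2 : S → A → ℕ → ℝ) (hc : ∀ s a k, c1 s a k ≤ c2 s a k ∧ c2 s a k ≤ c1 s a k + 1)
    (s0 : S) (ε L : ℝ) (hε : 0 < ε) (hL : (H : ℝ) < L) (η : ℝ) (hη : 0 < η) (x : S × A × Fin H)
    (hfin : ∫⁻ R, ENNReal.ofReal (bq 𝒞 c2 s0 ε x R)
      ∂(Measure.pi fun _ : S × A × Fin H => expMeasure η) ≠ ∞) :
    ∫⁻ R, (NN 𝒞 c1 x)ᶜ.indicator (GG 𝒞 c2 s0 ε x) R
      ∂(Measure.pi fun _ : S × A × Fin H => expMeasure η)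
      ≤ ENNReal.ofReal (η * L) * (ENNReal.ofReal (Real.exp (η * ε)) *
        ∫⁻ R, ENNReal.ofReal (bq 𝒞 c2 s0 ε x R)
          ∂(Measure.pi fun _ : S × A × Fin H => expMeasure η)) := by
  have hL0 : 0 ≤ L := (Nat.cast_nonneg H).trans hL.le
  have h1 : ∫⁻ R, GG 𝒞 c2 s0 ε x R ∂(Measure.pi fun _ : S × A × Fin H => expMeasure η)
      ≤ ENNReal.ofReal (Real.exp (η * ε)) * ∫⁻ R, ENNReal.ofReal (bq 𝒞 c2 s0 ε x R)
          ∂(Measure.pi fun _ : S × A × Fin H => expMeasure η) := by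
    refine le_trans (lintegral_mono fun R => ?_) (pi_shift η hη ε hε.le x _
      (bq_measurable 𝒞 hC c2 s0 ε x).ennreal_ofReal)
    rw [← dq_eq_bq]
    exact Set.indicator_le_self _ _ _
  refine (window η hη L hL0 x (GG 𝒞 c2 s0 ε x)
    ((dq_measurable 𝒞 hC c2 s0 ε x).ennreal_ofReal.indicator (MM_meas 𝒞 hC c2 x))
    (NN 𝒞 c1 x) (NN_meas 𝒞 hC c1 x)
    (GG_shift 𝒞 hne hC hprob c1 c2 hc s0 ε L hε hL x) ?_).trans (mul_le_mul' le_rfl h1)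
  exact ne_top_of_le_ne_top (ENNReal.mul_ne_top ENNReal.ofReal_ne_top hfin) h1

end FPOPCombine

/-- Under the FPOP algorithm, if `η ≤ H⁻²`, then for every episode `t`,
`E[v̂_t] ≤ E[v̄_t] + (e−1) η H³`, where `v̂_t = W(r_t, π̂_t, P̂_t, s^t_1)`,
`v̄_t = W(r_t, π_t, P̂_t, s^t_1)`, and the expectation is over the algorithm's randomness
(the current epoch's perturbation, the confidence set of the current epoch being fixed). -/
theorem fpop_lookahead_value_stability
    {S A : Type} [Fintype S] [Fintype A] [Nonempty S] [Nonempty A]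
    {Ω : Type} [MeasurableSpace Ω] (P : Measure Ω) [IsProbabilityMeasure P]
    (H T : ℕ) (hH : 0 < H) (hT : 0 < T)
    (η : ℝ) (hη : 0 < η) (hηH : η ≤ ((H : ℝ) ^ 2)⁻¹)
    -- initial states of the episodes
    (sInit : ℕ → S)
    -- the adversarially chosen rewards, with values in [0,1]
    (r : ℕ → S → A → ℕ → ℝ) (hr : ∀ t s a h, 0 ≤ r t s a h ∧ r t s a h ≤ 1)
    -- the confidence sets of the current epoch (fixed, nonempty, compact sets of
    -- probability distributions)
    (𝒞 : ℕ → S → A → Set (S → ℝ))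
    (hne : ∀ t s a, (𝒞 t s a).Nonempty)
    (hcompact : ∀ t s a, IsCompact (𝒞 t s a))
    (hprob : ∀ t s a, ∀ Q ∈ 𝒞 t s a, (∀ s', 0 ≤ Q s') ∧ ∑ s' : S, Q s' = 1)
    -- the current epoch's random perturbation: i.i.d. Exp(η) entries
    (R0 : ℕ → Ω → S → A → ℕ → ℝ)
    (hR0dist : ∀ t s a h, 1 ≤ h → h ≤ H →
      Measure.map (fun ω => R0 t ω s a h) P = expMeasure η)
    (hR0indep : ∀ t, iIndepFun
      (fun (x : S × A × Fin H) ω => R0 t ω x.1 x.2.1 (x.2.2.val + 1)) P)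
    -- (π_t, P̃_t) is the EVI solution for r_{0:t−1}, (π̂_t, P̂_t) the one for r_{0:t}
    (πt πhat : ℕ → Ω → S → ℕ → A)
    (Pt Phat : ℕ → Ω → ℕ → S → A → S → ℝ)
    (hπt : ∀ t ω, EVIConsistent (𝒞 t)
      (fun s a h => R0 t ω s a h + ∑ τ ∈ Finset.Icc 1 (t - 1), r τ s a h) H
      (πt t ω) (Pt t ω))
    (hπhat : ∀ t ω, EVIConsistent (𝒞 t)
      (fun s a h => R0 t ω s a h + ∑ τ ∈ Finset.Icc 1 t, r τ s a h) H
      (πhat t ω) (Phat t ω))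
    (hmeas : ∀ t, Measurable (fun ω => polValL (Phat t ω) (r t) (πhat t ω) H 1 (sInit t))
      ∧ Measurable (fun ω => polValL (Phat t ω) (r t) (πt t ω) H 1 (sInit t))) :
    ∀ t, 1 ≤ t → t ≤ T →
      ∫ ω, polValL (Phat t ω) (r t) (πhat t ω) H 1 (sInit t) ∂P
        ≤ ∫ ω, polValL (Phat t ω) (r t) (πt t ω) H 1 (sInit t) ∂P
            + (Real.exp 1 - 1) * η * H ^ 3 := by
  classical
  intro t ht _
  have hexpP := isProbabilityMeasure_expMeasure hη
  -- notation for the fixed episode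
  set c1 : S → A → ℕ → ℝ := fun s a h => ∑ τ ∈ Finset.Icc 1 (t - 1), r τ s a h with hc1
  set c2 : S → A → ℕ → ℝ := fun s a h => ∑ τ ∈ Finset.Icc 1 t, r τ s a h with hc2
  have hc12 : ∀ s a k, c2 s a k = c1 s a k + r t s a k := by
    intro s a k
    obtain ⟨u, rfl⟩ : ∃ u, t = u + 1 := ⟨t - 1, by omega⟩
    simp only [hc1, hc2, Nat.add_sub_cancel]
    rw [Finset.sum_Icc_succ_top (by omega)]
  have hc : ∀ s a k, c1 s a k ≤ c2 s a k ∧ c2 s a k ≤ c1 s a k + 1 := by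
    intro s a k
    have := hr t s a k
    rw [hc12]
    constructor <;> linarith
  have hc1n : ∀ s a k, 0 ≤ c1 s a k := fun s a k => Finset.sum_nonneg fun τ _ => (hr τ s a k).1
  have hc2n : ∀ s a k, 0 ≤ c2 s a k := fun s a k => Finset.sum_nonneg fun τ _ => (hr τ s a k).1
  let R : Ω → (S × A × Fin H → ℝ) := fun ω x => R0 t ω x.1 x.2.1 (x.2.2.val + 1)
  have hRx : ∀ x : S × A × Fin H, P.map (fun ω => R ω x) = expMeasure η := fun x =>
    hR0dist t x.1 x.2.1 (x.2.2.val + 1) (by omega) (by have := x.2.2.2; omega)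
  have hRxm : ∀ x : S × A × Fin H, AEMeasurable (fun ω => R ω x) P := fun x =>
    aemeasurable_of_map_neZero (by rw [hRx x]; infer_instance)
  have hRm : AEMeasurable R P := aemeasurable_pi_lambda _ hRxm
  have hlaw : P.map R = Measure.pi (fun _ : S × A × Fin H => expMeasure η) := by
    have := (iIndepFun_iff_map_fun_eq_pi_map hRxm).1 (hR0indep t)
    rw [show P.map R = P.map (fun ω i => R ω i) from rfl, this]
    congr 1
    funext x
    exact hRx x
  have hRn : ∀ᵐ ω ∂P, ∀ x, 0 ≤ R ω x := by
    rw [ae_all_iff]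
    intro x
    have := exp_nonneg_ae η
    rw [← hRx x] at this
    exact ae_of_ae_map (hRxm x) this
  have hext : ∀ ω k, 1 ≤ k → k ≤ H → ∀ s a, extR (R ω) s a k = R0 t ω s a k := by
    intro ω k hk hk' s a
    unfold extR
    rw [dif_pos (by omega)]
    simp only [R]
    rw [Nat.sub_add_cancel hk]
  -- consistency for the rewards `rew c (R ω)`
  have hcons : ∀ (c : S → A → ℕ → ℝ) (ω : Ω) (π : S → ℕ → A) (p : ℕ → S → A → S → ℝ),
      (∀ s a k, 0 ≤ c s a k) → (∀ x, 0 ≤ R ω x) →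
      EVIConsistent (𝒞 t) (fun s a h => R0 t ω s a h + c s a h) H π p →
      (∀ (x : S × A × Fin H) a, qv (𝒞 t) (rew c (R ω)) (H - (x.2.2.val + 1)) (x.2.2.val + 1) x.1 a
        ≤ qv (𝒞 t) (rew c (R ω)) (H - (x.2.2.val + 1)) (x.2.2.val + 1) x.1
          (π x.1 (x.2.2.val + 1))) ∧
      polValL p (rew c (R ω)) π H 1 (sInit t) = FF (𝒞 t) c (sInit t) (R ω) := by
    intro c ω π p hcn hn hE
    have heq : ∀ k, 1 ≤ k → k ≤ H → ∀ s a, R0 t ω s a k + c s a k = rew c (R ω) s a k := by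
      intro k hk hk' s a
      unfold rew
      rw [hext ω k hk hk']
    have hnn : ∀ k, 1 ≤ k → k ≤ H → ∀ s a, 0 ≤ R0 t ω s a k + c s a k := by
      intro k hk hk' s a
      rw [heq k hk hk']
      refine add_nonneg ?_ (hcn s a k)
      unfold extR
      split_ifs
      · exact hn _
      · exact le_rfl
    constructor
    · intro x a
      have hx := x.2.2.2
      have h1 := greedy (𝒞 t) (hne t) (hcompact t) (hprob t) _ H hnn π p hE (x.2.2.val + 1)
        (by omega) (by omega) x.1
      have h2 : ∀ b, qv (𝒞 t) (fun s a h => R0 t ω s a h + c s a h) (H - (x.2.2.val + 1))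
          (x.2.2.val + 1) x.1 b
          = qv (𝒞 t) (rew c (R ω)) (H - (x.2.2.val + 1)) (x.2.2.val + 1) x.1 b := by
        intro b
        unfold qv
        have h3 : eviC (𝒞 t) (fun s a h => R0 t ω s a h + c s a h) (H - (x.2.2.val + 1))
            (x.2.2.val + 1 + 1) = eviC (𝒞 t) (rew c (R ω)) (H - (x.2.2.val + 1))
            (x.2.2.val + 1 + 1) := by
          apply eviC_congr
          intro k hk hk' s a
          exact heq k (by omega) (by omega) s a
        rw [h3]
        have h5 := heq (x.2.2.val + 1) (by omega) (by omega) x.1 b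
        simp only [h5]
      have h3 := h1 a
      rwa [h2, h2] at h3
    · have h1 := hE.2 1 (sInit t) le_rfl hH
      rw [Nat.add_sub_cancel, (evi_eq_eviC (𝒞 t) (hne t) (hcompact t) (hprob t) _ H 1
        (fun k hk hk' => hnn k hk (by omega))).1] at h1
      rw [eviC_congr (𝒞 t) _ (rew c (R ω)) H 1
        (fun k hk hk' s a => heq k hk (by omega) s a)] at h1
      rw [pv_congr _ _ (rew c (R ω)) _ H 1
        (fun k hk hk' s => heq k hk (by omega) s _)] at h1
      exact h1
  have hp0 : ∀ ω h s a s', 0 ≤ Phat t ω h s a s' := fun ω h s a s' =>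
    (hprob t s a _ ((hπhat t ω).1 h s a)).1 s'
  have hp1 : ∀ ω h s a, ∑ s', Phat t ω h s a s' = 1 := fun ω h s a =>
    (hprob t s a _ ((hπhat t ω).1 h s a)).2
  -- constants
  obtain ⟨ε, hεdef⟩ : ∃ ε : ℝ, ε = 1 / (4 * η) := ⟨_, rfl⟩
  have hε : 0 < ε := by rw [hεdef]; positivity
  have hηε : η * ε = 1 / 4 := by rw [hεdef]; field_simp
  have hHpos : (0 : ℝ) < H := by exact_mod_cast hH
  obtain ⟨L, hLdef⟩ : ∃ L : ℝ, L = 5 / 4 * H := ⟨_, rfl⟩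
  have hL : (H : ℝ) < L := by rw [hLdef]; linarith
  -- the backward quotients
  let I : S × A × Fin H → ENNReal := fun x => ∫⁻ R', ENNReal.ofReal (bq (𝒞 t) c2 (sInit t) ε x R')
      ∂(Measure.pi fun _ : S × A × Fin H => expMeasure η)
  have hI : ∑ x, I x ≤ ENNReal.ofReal H := by
    simp only [I]
    rw [← lintegral_finsetSum _ (fun x _ =>
      (bq_measurable (𝒞 t) (hcompact t) c2 (sInit t) ε x).ennreal_ofReal), ← hlaw,
      lintegral_map' (Finset.measurable_fun_sum _ (fun x _ =>
      (bq_measurable (𝒞 t) (hcompact t) c2 (sInit t) ε x).ennreal_ofReal)).aemeasurable hRm]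
    have : ∀ᵐ ω ∂P, ∑ x, ENNReal.ofReal (bq (𝒞 t) c2 (sInit t) ε x (R ω)) ≤ ENNReal.ofReal H := by
      filter_upwards [hRn] with ω hω
      have hco := (hcons c2 ω _ _ hc2n hω (hπhat t ω)).2
      rw [← sum_occ (H := H) (Phat t ω) (hp1 ω) (πhat t ω) (sInit t),
        ENNReal.ofReal_sum_of_nonneg]
      · refine Finset.sum_le_sum fun x _ => ENNReal.ofReal_le_ofReal ?_
        exact bq_le_occ (𝒞 t) (hcompact t) (hprob t) (Phat t ω) (hπhat t ω).1 (πhat t ω) c2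
          (sInit t) (R ω) hco x ε hε
      · intro x _
        refine pv_nonneg _ (hp0 ω) _ ?_ _ _ _ _
        intro s a k
        unfold ind
        split_ifs <;> norm_num
    refine (lintegral_mono_ae this).trans ?_
    simp
  have hIfin : ∀ x, I x ≠ ⊤ := fun x => ne_top_of_le_ne_top ENNReal.ofReal_ne_top
    ((Finset.single_le_sum (f := I) (fun _ _ => zero_le) (Finset.mem_univ x)).trans hI)
  -- pointwise bound
  have hpt : ∀ᵐ ω ∂P, ENNReal.ofReal (polValL (Phat t ω) (r t) (πhat t ω) H 1 (sInit t)
      - polValL (Phat t ω) (r t) (πt t ω) H 1 (sInit t))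
      ≤ ENNReal.ofReal H * ∑ x : S × A × Fin H,
        (NN (𝒞 t) c1 x)ᶜ.indicator (GG (𝒞 t) c2 (sInit t) ε x) (R ω) := by
    filter_upwards [hRn] with ω hω
    have hco := hcons c2 ω _ _ hc2n hω (hπhat t ω)
    have hco1 := hcons c1 ω _ _ hc1n hω (hπt t ω)
    refine (ENNReal.ofReal_le_ofReal (diff_occ (H := H) (Phat t ω) (hp0 ω) (hp1 ω) (r t) (hr t)
      (πt t ω) (πhat t ω) (sInit t))).trans ?_
    have hocc : ∀ x : S × A × Fin H, 0 ≤ polValL (Phat t ω) (ind x) (πhat t ω) H 1 (sInit t) := by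
      intro x
      refine pv_nonneg _ (hp0 ω) _ ?_ _ _ _ _
      intro s a k
      unfold ind
      split_ifs <;> norm_num
    rw [ENNReal.ofReal_mul hHpos.le, ENNReal.ofReal_sum_of_nonneg]
    · refine mul_le_mul' le_rfl (Finset.sum_le_sum fun x _ => ?_)
      split_ifs with hx
      · have hM : R ω ∈ MM (𝒞 t) c2 x := by
          intro a'
          have := hco.1 x a'
          rwa [hx.1] at this
        have hN : R ω ∈ (NN (𝒞 t) c1 x)ᶜ := by
          intro hN
          have h1 := hN _ hx.2
          have h2 := hco1.1 x x.2.1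
          linarith
        rw [Set.indicator_of_mem hN]
        unfold GG
        rw [Set.indicator_of_mem hM]
        exact ENNReal.ofReal_le_ofReal (occ_le_dq (𝒞 t) (hcompact t) (hprob t) (Phat t ω)
          (hπhat t ω).1 (πhat t ω) c2 (sInit t) (R ω) hco.2 x ε hε)
      · simp
    · intro x _
      split_ifs
      · exact hocc x
      · exact le_rfl
  -- integrated bound
  have hGm : ∀ x : S × A × Fin H,
      Measurable ((NN (𝒞 t) c1 x)ᶜ.indicator (GG (𝒞 t) c2 (sInit t) ε x)) := fun x =>
    ((dq_measurable (𝒞 t) (hcompact t) c2 (sInit t) ε x).ennreal_ofReal.indicator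
      (MM_meas (𝒞 t) (hcompact t) c2 x)).indicator (NN_meas (𝒞 t) (hcompact t) c1 x).compl
  have hIntB : ∫⁻ ω, ENNReal.ofReal (polValL (Phat t ω) (r t) (πhat t ω) H 1 (sInit t)
      - polValL (Phat t ω) (r t) (πt t ω) H 1 (sInit t)) ∂P
      ≤ ENNReal.ofReal (H * (η * L * (Real.exp (η * ε) * H))) := by
    refine (lintegral_mono_ae hpt).trans ?_
    have e1 := lintegral_map' (μ := P) (g := R) (f := fun R' => ENNReal.ofReal H *
      ∑ x : S × A × Fin H, (NN (𝒞 t) c1 x)ᶜ.indicator (GG (𝒞 t) c2 (sInit t) ε x) R')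
      (((Finset.measurable_fun_sum _ (fun x _ => hGm x)).const_mul _).aemeasurable) hRm
    rw [← e1, hlaw, lintegral_const_mul _ (Finset.measurable_fun_sum _ (fun x _ => hGm x)),
      lintegral_finsetSum _ (fun x _ => hGm x)]
    have hL0 : 0 ≤ η * L := mul_nonneg hη.le (hHpos.le.trans hL.le)
    rw [ENNReal.ofReal_mul hHpos.le, ENNReal.ofReal_mul hL0,
      ENNReal.ofReal_mul (Real.exp_pos _).le]
    refine mul_le_mul' le_rfl ?_
    refine (Finset.sum_le_sum fun x _ => entry_bound (𝒞 t) (hne t) (hcompact t) (hprob t) c1 c2 hc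
      (sInit t) ε L hε hL η hη x (hIfin x)).trans ?_
    rw [← Finset.mul_sum, ← Finset.mul_sum]
    exact mul_le_mul' le_rfl (mul_le_mul' le_rfl hI)
  -- numerical constant
  have hnum : (H : ℝ) * (η * L * (Real.exp (η * ε) * H)) ≤ (Real.exp 1 - 1) * η * H ^ 3 := by
    have he : Real.exp (1 / 4) ≤ 1.3 := by
      have h4 : Real.exp (1 / 4) ^ 4 = Real.exp 1 := by
        rw [← Real.exp_nat_mul]; norm_num
      by_contra hlt
      push Not at hlt
      have := pow_lt_pow_left₀ hlt (by norm_num) (n := 4) (by norm_num)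
      have h5 := Real.exp_one_lt_d9
      rw [h4] at this
      norm_num at this h5
      linarith
    have h6 := Real.exp_one_gt_d9
    rw [hηε, hLdef]
    have h7 : 5 / 4 * Real.exp (1 / 4) ≤ Real.exp 1 - 1 := by
      norm_num at he h6 ⊢
      linarith
    have h8 : 0 ≤ η * (H : ℝ) ^ 3 := by positivity
    have h9 := mul_le_mul_of_nonneg_right h7 h8
    calc (H : ℝ) * (η * (5 / 4 * H) * (Real.exp (1 / 4) * H))
        = 5 / 4 * Real.exp (1 / 4) * (η * H ^ 3) := by ring
      _ ≤ (Real.exp 1 - 1) * (η * H ^ 3) := h9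
      _ = _ := by ring
  -- conclusion
  have hbd : ∀ (π : Ω → S → ℕ → A),
      Measurable (fun ω => polValL (Phat t ω) (r t) (π ω) H 1 (sInit t)) →
      Integrable (fun ω => polValL (Phat t ω) (r t) (π ω) H 1 (sInit t)) P := by
    intro π hm
    refine Integrable.of_bound hm.aestronglyMeasurable (H : ℝ) (Filter.Eventually.of_forall fun ω => ?_)
    rw [Real.norm_of_nonneg (pv_nonneg _ (hp0 ω) _ (fun s a k => (hr t s a k).1) _ _ _ _)]
    exact pv_le _ (hp0 ω) (hp1 ω) _ (fun s a k => (hr t s a k).2) _ _ _ _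
  have i1 := hbd (πhat t) (hmeas t).1
  have i2 := hbd (πt t) (hmeas t).2
  have hsub := integral_sub i1 i2
  have hle : ∫ ω, (polValL (Phat t ω) (r t) (πhat t ω) H 1 (sInit t)
      - polValL (Phat t ω) (r t) (πt t ω) H 1 (sInit t)) ∂P
      ≤ H * (η * L * (Real.exp (η * ε) * H)) := by
    have h0 := integral_eq_lintegral_pos_part_sub_lintegral_neg_part (i1.sub i2)
    simp only [Pi.sub_apply] at h0
    rw [h0]
    have h1 := ENNReal.toReal_mono ENNReal.ofReal_ne_top hIntB
    rw [ENNReal.toReal_ofReal (by rw [hLdef]; positivity)] at h1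
    have h2 : 0 ≤ (∫⁻ ω, ENNReal.ofReal (-(polValL (Phat t ω) (r t) (πhat t ω) H 1 (sInit t)
      - polValL (Phat t ω) (r t) (πt t ω) H 1 (sInit t))) ∂P).toReal := ENNReal.toReal_nonneg
    linarith
  linarith
end
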